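/- Let 𝒩₂⁽²⁾(N) denote the number of subsets S of {1,…,N²} with |S| = N, Σ_{i∈S} i = N(N²+1)/2, and Σ_{i∈S} i² = N(N²+1)(2N²+1)/6. Then, as N → ∞, 𝒩₂⁽²⁾(N) = (6/π^{3/2})·√(30/e) · (N·e)^N / N^{15/2} · (1 + 1787/(2940N) + o(1/N)); equivalently, (π^{3/2}/6)·√(e/30)·N^{15/2}·(N·e)^{−N}·𝒩₂⁽²⁾(N) − (1 + 1787/(2940N)) = o(1/N). -/

import Mathlib

open Filter Asymptotics

/-- The number of bimagic square series of order `N`: subsets of `{1,…,N²}` with `N`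
elements whose elements sum to `N(N²+1)/2` and whose squares sum to
`N(N²+1)(2N²+1)/6`. -/
def bimagicSquareSeries (N : ℕ) : ℕ :=
  ((Finset.Icc 1 (N ^ 2)).powerset.filter
    (fun S => S.card = N ∧ ∑ i ∈ S, i = N * (N ^ 2 + 1) / 2 ∧
      ∑ i ∈ S, i ^ 2 = N * (N ^ 2 + 1) * (2 * N ^ 2 + 1) / 6)).card

/-- The quadratic phase `v₀ + v₁ i + v₂ (i choose 2)`. -/
noncomputable def quadPhase (v : Fin 3 → ℝ) (i : ℕ) : ℝ :=
  v 0 + v 1 * i + v 2 * (i * (i - 1) / 2)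

lemma two_mul_abs_le_abs_sin_pi_mul {y : ℝ} (hy : |y| ≤ 1 / 2) :
    2 * |y| ≤ |Real.sin (Real.pi * y)| := by
  have h := Real.mul_abs_le_abs_sin (x := Real.pi * y) (by
    rw [abs_mul, abs_of_pos Real.pi_pos]; nlinarith [Real.pi_pos])
  rw [abs_mul, abs_of_pos Real.pi_pos] at h
  calc 2 * |y| = 2 / Real.pi * (Real.pi * |y|) := by field_simp
    _ ≤ _ := h

lemma abs_sin_add_le (a b : ℝ) : |Real.sin (a + b)| ≤ |Real.sin a| + |Real.sin b| := by
  rw [Real.sin_add]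
  refine (abs_add_le _ _).trans ?_
  rw [abs_mul, abs_mul]
  gcongr
  · exact mul_le_of_le_one_right (abs_nonneg _) (Real.abs_cos_le_one _)
  · exact mul_le_of_le_one_left (abs_nonneg _) (Real.abs_cos_le_one _)

lemma abs_sin_pi_mul_le (y : ℝ) : |Real.sin (Real.pi * y)| ≤ 4 * |y| := by
  refine Real.abs_sin_le_abs.trans ?_
  rw [abs_mul, abs_of_pos Real.pi_pos]
  gcongr
  exact Real.pi_le_four

/-- If all dilates `b h ^ k` with `h ≤ H` are close to integers and `|b| ≤ 1/2`, then they are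
small. -/
lemma two_mul_abs_mul_pow_le {b δ : ℝ} {k H : ℕ} (hk : k ≤ 2) (hb : |b| ≤ 1 / 2) (hδ : δ ≤ 1 / 4)
    (hsin : ∀ h : ℕ, 1 ≤ h → h ≤ H → |Real.sin (Real.pi * (b * (h : ℝ) ^ k))| ≤ δ) (h : ℕ)
    (h1 : 1 ≤ h) (hH : h ≤ H) : 2 * (|b| * (h : ℝ) ^ k) ≤ δ := by
  have habs : ∀ h : ℕ, |b * (h : ℝ) ^ k| = |b| * (h : ℝ) ^ k := fun h => by
    rw [abs_mul, abs_of_nonneg (by positivity : (0 : ℝ) ≤ (h : ℝ) ^ k)]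
  induction h, h1 using Nat.le_induction with
  | base =>
    have := hsin 1 le_rfl hH
    simp only [Nat.cast_one, one_pow, mul_one] at this ⊢
    exact (two_mul_abs_le_abs_sin_pi_mul hb).trans this
  | succ h h1 ih =>
    have ih := ih (by omega)
    have hh : ((h + 1 : ℕ) : ℝ) ^ k ≤ 4 * (h : ℝ) ^ k := by
      have h1' : (1 : ℝ) ≤ h := by exact_mod_cast h1
      calc ((h + 1 : ℕ) : ℝ) ^ k ≤ (2 * h : ℝ) ^ k := by
            push_cast; gcongr; linarith
        _ = 2 ^ k * (h : ℝ) ^ k := mul_pow _ _ _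
        _ ≤ 2 ^ 2 * (h : ℝ) ^ k := by gcongr; norm_num
        _ = _ := by norm_num
    have hs : |b * ((h + 1 : ℕ) : ℝ) ^ k| ≤ 1 / 2 := by
      rw [habs]
      nlinarith [abs_nonneg b, mul_le_mul_of_nonneg_left hh (abs_nonneg b)]
    have := (two_mul_abs_le_abs_sin_pi_mul hs).trans (hsin (h + 1) (by omega) hH)
    rwa [habs] at this

lemma sum_range_shift_le {g : ℕ → ℝ} (hg : ∀ i, 0 ≤ g i) {M m d : ℕ} (h : m + d ≤ M) :
    ∑ j ∈ Finset.range m, g (j + d) ≤ ∑ i ∈ Finset.range M, g i := by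
  calc ∑ j ∈ Finset.range m, g (j + d) = ∑ i ∈ Finset.Ico d (m + d), g i := by
        rw [Finset.sum_Ico_eq_sum_range]; simp [add_comm]
    _ ≤ _ := Finset.sum_le_sum_of_subset_of_nonneg
        (fun i hi => by simp at hi ⊢; omega) fun i _ _ => hg i

/-- A quantity bounded by a sum of nearly-integral phases over at least half of the range is
small. -/
lemma le_of_forall_sq_le {x A : ℝ} {m M : ℕ} {G : ℕ → ℝ} {B : ℝ} (hm : (M : ℝ) / 2 ≤ m)
    (hM : 0 < M) (hB : 0 ≤ B) (hx : ∀ j < m, x ^ 2 ≤ G j)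
    (hG : ∑ j ∈ Finset.range m, G j ≤ A * m) (hA : A ≤ B ^ 2) : x ≤ B := by
  have hm' : (0 : ℝ) < m := by
    have : (0 : ℝ) < M := by exact_mod_cast hM
    linarith
  have h1 : ∑ j ∈ Finset.range m, x ^ 2 ≤ ∑ j ∈ Finset.range m, G j :=
    Finset.sum_le_sum fun j hj => hx j (Finset.mem_range.1 hj)
  simp only [Finset.sum_const, Finset.card_range, nsmul_eq_mul] at h1
  have h2 : x ^ 2 ≤ A := by
    by_contra hcon
    push Not at hcon
    nlinarith
  exact le_of_sq_le_sq (h2.trans hA) hB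

/-- If a quadratic phase with coefficients in `[-1/2, 1/2]` is close to an integer in mean square,
then it is uniformly small. -/
lemma quadPhase_abs_le {v : Fin 3 → ℝ} (hv : ∀ k, |v k| ≤ 1 / 2) {M : ℕ} (hM : 8 ≤ M) {ε : ℝ}
    (hε0 : 0 ≤ ε) (hε : ε ≤ 1 / 200000)
    (hsum : ∑ i ∈ Finset.range M, Real.sin (Real.pi * quadPhase v i) ^ 2 ≤ ε ^ 2 * M) :
    ∀ i < M, |quadPhase v i| ≤ 12000 * ε := by
  have hM' : (8 : ℝ) ≤ M := by exact_mod_cast hM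
  set n : ℕ → ℝ := fun i => |Real.sin (Real.pi * quadPhase v i)| with hn
  have hn0 : ∀ i, 0 ≤ n i ^ 2 := fun i => sq_nonneg _
  have hsum' : ∑ i ∈ Finset.range M, n i ^ 2 ≤ ε ^ 2 * M := by simpa [hn] using hsum
  have hshift : ∀ m d : ℕ, m + d ≤ M → (M : ℝ) / 2 ≤ m →
      ∑ j ∈ Finset.range m, n (j + d) ^ 2 ≤ 2 * ε ^ 2 * m := fun m d h h2 =>
    ((sum_range_shift_le hn0 h).trans hsum').trans (by nlinarith [sq_nonneg ε])
  -- the quadratic coefficient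
  have hβ : ∀ h : ℕ, 1 ≤ h → h ≤ M / 4 → 2 * (|v 2| * (h : ℝ) ^ 2) ≤ 6 * ε := by
    refine two_mul_abs_mul_pow_le le_rfl (hv 2) (by linarith) fun h _ hH => ?_
    have hhM : 4 * h ≤ M := by omega
    have hm : (M : ℝ) / 2 ≤ (M - 2 * h : ℕ) := by
      rw [Nat.cast_sub (by omega)]
      have : (4 * h : ℝ) ≤ M := by exact_mod_cast hhM
      push_cast; linarith
    refine le_of_forall_sq_le (M := M) (m := M - 2 * h) (A := 32 * ε ^ 2)
      (G := fun j => 4 * (n (j + 2 * h) ^ 2 + 2 * n (j + h) ^ 2 + n (j + 0) ^ 2))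
      hm (by omega) (by positivity) (fun j _ => ?_) ?_ (by nlinarith [sq_nonneg ε])
    · have key : |Real.sin (Real.pi * (v 2 * (h : ℝ) ^ 2))| ≤
          n (j + 2 * h) + 2 * n (j + h) + n (j + 0) := by
        have e : Real.pi * (v 2 * (h : ℝ) ^ 2) = (Real.pi * quadPhase v (j + 2 * h) +
            (-(Real.pi * quadPhase v (j + h)) + -(Real.pi * quadPhase v (j + h)))) +
            Real.pi * quadPhase v (j + 0) := by
          simp only [quadPhase]; push_cast; ring
        rw [e]
        refine (abs_sin_add_le _ _).trans ?_
        gcongr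
        refine (abs_sin_add_le _ _).trans ?_
        gcongr
        refine (abs_sin_add_le _ _).trans ?_
        rw [Real.sin_neg, abs_neg, two_mul]
      refine (pow_le_pow_left₀ (abs_nonneg _) key 2).trans ?_
      nlinarith [sq_nonneg (n (j + 2 * h) - n (j + h)), sq_nonneg (n (j + 2 * h) - n (j + 0)),
        sq_nonneg (n (j + h) - n (j + 0))]
    · rw [← Finset.mul_sum, Finset.sum_add_distrib, Finset.sum_add_distrib, ← Finset.mul_sum]
      have h1 := hshift (M - 2 * h) (2 * h) (by omega) hm
      have h2 := hshift (M - 2 * h) h (by omega) hm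
      have h3 := hshift (M - 2 * h) 0 (by omega) hm
      linarith
  have hβM : |v 2| * (M : ℝ) ^ 2 ≤ 192 * ε := by
    have h1 := hβ (M / 4) (by omega) le_rfl
    have h2 : (M : ℝ) / 8 ≤ (M / 4 : ℕ) := by
      have : M ≤ 8 * (M / 4) := by omega
      have : (M : ℝ) ≤ 8 * (M / 4 : ℕ) := by exact_mod_cast this
      linarith
    have h3 : ((M : ℝ) / 8) ^ 2 ≤ ((M / 4 : ℕ) : ℝ) ^ 2 := by gcongr
    nlinarith [mul_le_mul_of_nonneg_left h3 (abs_nonneg (v 2))]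
  -- the linear coefficient
  have hα : ∀ h : ℕ, 1 ≤ h → h ≤ M / 2 → 2 * (|v 1| * (h : ℝ) ^ 1) ≤ 1400 * ε := by
    refine two_mul_abs_mul_pow_le (by norm_num) (hv 1) (by linarith) fun h _ hH => ?_
    have hhM : 2 * h ≤ M := by omega
    have hm : (M : ℝ) / 2 ≤ (M - h : ℕ) := by
      rw [Nat.cast_sub (by omega)]
      have : (2 * h : ℝ) ≤ M := by exact_mod_cast hhM
      linarith
    refine le_of_forall_sq_le (M := M) (m := M - h) (A := 12 * ε ^ 2 + 3 * (768 * ε) ^ 2)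
      (G := fun j => 3 * (n (j + h) ^ 2 + n (j + 0) ^ 2 + (768 * ε) ^ 2))
      hm (by omega) (by positivity) (fun j hj => ?_) ?_ (by nlinarith [sq_nonneg ε])
    · have key : |Real.sin (Real.pi * (v 1 * (h : ℝ) ^ 1))| ≤
          n (j + h) + n (j + 0) + 768 * ε := by
        have e : Real.pi * (v 1 * (h : ℝ) ^ 1) = (Real.pi * quadPhase v (j + h) +
            -(Real.pi * quadPhase v (j + 0))) +
            Real.pi * (-(v 2 * (h * j + h * (h - 1) / 2))) := by
          simp only [quadPhase]; push_cast; ring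
        rw [e]
        refine (abs_sin_add_le _ _).trans ?_
        gcongr
        · refine (abs_sin_add_le _ _).trans ?_
          rw [Real.sin_neg, abs_neg]
        · refine (abs_sin_pi_mul_le _).trans ?_
          rw [abs_neg, abs_mul]
          have hj' : (j : ℝ) + h ≤ M := by
            have : j + h ≤ M := by omega
            exact_mod_cast this
          have h0 : (1 : ℝ) ≤ h := by exact_mod_cast ‹1 ≤ h›
          have hj0 : (0 : ℝ) ≤ j := by positivity
          have : |(h * j + h * (h - 1) / 2 : ℝ)| ≤ (M : ℝ) ^ 2 := by
            rw [abs_of_nonneg (by nlinarith [mul_nonneg hj0 (by linarith : (0 : ℝ) ≤ h)])]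
            nlinarith [mul_nonneg hj0 (by linarith : (0 : ℝ) ≤ h)]
          nlinarith [mul_le_mul_of_nonneg_left this (abs_nonneg (v 2))]
      refine (pow_le_pow_left₀ (abs_nonneg _) key 2).trans ?_
      nlinarith [sq_nonneg (n (j + h) - n (j + 0)), sq_nonneg (n (j + h) - 768 * ε),
        sq_nonneg (n (j + 0) - 768 * ε)]
    · rw [← Finset.mul_sum, Finset.sum_add_distrib, Finset.sum_add_distrib]
      have h1 := hshift (M - h) h (by omega) hm
      have h2 := hshift (M - h) 0 (by omega) hm
      simp only [Finset.sum_const, Finset.card_range, nsmul_eq_mul]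
      linarith
  have hαM : |v 1| * (M : ℝ) ≤ 2800 * ε := by
    have h1 := hα (M / 2) (by omega) le_rfl
    have h2 : (M : ℝ) / 4 ≤ (M / 2 : ℕ) := by
      have : M ≤ 4 * (M / 2) := by omega
      have : (M : ℝ) ≤ 4 * (M / 2 : ℕ) := by exact_mod_cast this
      linarith
    nlinarith [mul_le_mul_of_nonneg_left h2 (abs_nonneg (v 1))]
  have hlin : ∀ j < M, |v 1 * j + v 2 * (j * (j - 1) / 2)| ≤ 2992 * ε := fun j hj => by
    have hj' : (j : ℝ) ≤ M := by exact_mod_cast hj.le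
    have hj0 : (0 : ℝ) ≤ j := by positivity
    have e : |(j * (j - 1) / 2 : ℝ)| ≤ (M : ℝ) ^ 2 := abs_le.2 ⟨by nlinarith, by nlinarith⟩
    refine (abs_add_le _ _).trans ?_
    rw [abs_mul, abs_mul, abs_of_nonneg hj0]
    have h1 := mul_le_mul_of_nonneg_left e (abs_nonneg (v 2))
    have h2 := mul_le_mul_of_nonneg_left hj' (abs_nonneg (v 1))
    linarith
  -- the constant coefficient
  have hγ : 2 * |v 0| ≤ 17000 * ε := by
    refine (two_mul_abs_le_abs_sin_pi_mul (hv 0)).trans ?_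
    refine le_of_forall_sq_le (M := M) (m := M) (A := 4 * ε ^ 2 + 2 * (12000 * ε) ^ 2)
      (G := fun j => 2 * (n (j + 0) ^ 2 + (12000 * ε) ^ 2))
      (by linarith) (by omega) (by positivity) (fun j hj => ?_) ?_ (by nlinarith [sq_nonneg ε])
    · have key : |Real.sin (Real.pi * v 0)| ≤ n (j + 0) + 12000 * ε := by
        have e : Real.pi * v 0 = Real.pi * quadPhase v (j + 0) +
            Real.pi * (-(v 1 * j + v 2 * (j * (j - 1) / 2))) := by
          simp only [quadPhase]; push_cast; ring
        rw [e]
        refine (abs_sin_add_le _ _).trans ?_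
        gcongr
        refine (abs_sin_pi_mul_le _).trans ?_
        rw [abs_neg]
        linarith [hlin j hj]
      refine (pow_le_pow_left₀ (abs_nonneg _) key 2).trans ?_
      nlinarith [sq_nonneg (n (j + 0) - 12000 * ε)]
    · rw [← Finset.mul_sum, Finset.sum_add_distrib]
      have h1 := hshift M 0 (by omega) (by linarith)
      simp only [Finset.sum_const, Finset.card_range, nsmul_eq_mul]
      linarith
  intro i hi
  have : quadPhase v i = v 0 + (v 1 * i + v 2 * (i * (i - 1) / 2)) := by
    simp only [quadPhase]; ring
  rw [this]
  refine (abs_add_le _ _).trans ?_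
  linarith [hlin i hi]

open Complex MeasureTheory in
/-- The characteristic function of a centred Bernoulli variable of parameter `p`. -/
noncomputable def bernoulliChar (p θ : ℝ) : ℂ :=
  ((1 - p : ℝ) + p * Complex.exp (θ * Complex.I)) * Complex.exp (-(p * θ : ℝ) * Complex.I)

/-- The cube `[-1/2, 1/2]³`, a fundamental domain of the torus. -/
def torusBox : Set (Fin 3 → ℝ) := Set.pi Set.univ fun _ => Set.Icc (-1 / 2) (1 / 2)

lemma exists_cube_eq_add_six_mul (N : ℕ) : ∃ c, N ^ 3 = N + 6 * c := by
  induction N with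
  | zero => exact ⟨0, rfl⟩
  | succ n ih =>
    obtain ⟨c, hc⟩ := ih
    obtain ⟨d, hd⟩ := Nat.even_mul_succ_self n
    exact ⟨c + d, by nlinarith⟩

lemma add_one_sq_eq_choose (i : ℕ) : (i + 1) ^ 2 = 2 * i.choose 2 + 3 * i + 1 := by
  have : ((i + 1 : ℕ) : ℚ) ^ 2 = 2 * (i.choose 2 : ℕ) + 3 * i + 1 := by
    rw [Nat.cast_choose_two]; push_cast; ring
  exact_mod_cast this

/-- The defining conditions in terms of binomial moments of the shifted set. -/
lemma bimagicSquareSeries_eq_card {N c : ℕ} (hc : N ^ 3 = N + 6 * c) :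
    bimagicSquareSeries N = ((Finset.range (N ^ 2)).powerset.filter fun S =>
      S.card = N ∧ ∑ i ∈ S, i = 3 * c ∧ ∑ i ∈ S, i.choose 2 + 2 * c = c * N ^ 2).card := by
  have h1 : N * (N ^ 2 + 1) / 2 = 3 * c + N :=
    Nat.div_eq_of_eq_mul_left (by norm_num) (by linarith)
  have h2 : N * (N ^ 2 + 1) * (2 * N ^ 2 + 1) / 6 = c * (2 * N ^ 2 + 5) + N := by
    refine Nat.div_eq_of_eq_mul_left (by norm_num) ?_
    calc N * (N ^ 2 + 1) * (2 * N ^ 2 + 1) = (N ^ 3 + N) * (2 * N ^ 2 + 1) := by ring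
      _ = 12 * c * N ^ 2 + 6 * c + 4 * N ^ 3 + 2 * N := by rw [hc]; linarith
      _ = _ := by rw [hc]; ring
  have hcond : ∀ S : Finset ℕ, (S.card = N ∧ ∑ i ∈ S, i = 3 * c ∧
      ∑ i ∈ S, i.choose 2 + 2 * c = c * N ^ 2) ↔
      ((S.map (addRightEmbedding 1)).card = N ∧
        ∑ i ∈ S.map (addRightEmbedding 1), i = N * (N ^ 2 + 1) / 2 ∧
        ∑ i ∈ S.map (addRightEmbedding 1), i ^ 2 = N * (N ^ 2 + 1) * (2 * N ^ 2 + 1) / 6) := by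
    intro S
    simp only [Finset.card_map, Finset.sum_map, addRightEmbedding_apply, h1, h2,
      add_one_sq_eq_choose, Finset.sum_add_distrib, ← Finset.mul_sum, Finset.sum_const,
      smul_eq_mul, mul_one]
    have h3 : ∑ i ∈ S, 3 * i = 3 * ∑ i ∈ S, i := (Finset.mul_sum _ _ _).symm
    constructor
    · rintro ⟨a, b, d⟩
      exact ⟨a, by omega, by nlinarith⟩
    · rintro ⟨a, b, d⟩
      exact ⟨a, by omega, by nlinarith⟩
  have hIcc : Finset.Icc 1 (N ^ 2) = (Finset.range (N ^ 2)).map (addRightEmbedding 1) := by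
    ext i
    simp only [Finset.mem_Icc, Finset.mem_map, Finset.mem_range, addRightEmbedding_apply]
    exact ⟨fun h => ⟨i - 1, by omega, by omega⟩, by rintro ⟨j, hj, rfl⟩; omega⟩
  symm
  refine Finset.card_bij (fun S _ => S.map (addRightEmbedding 1)) ?_ ?_ ?_
  · intro S hS
    rw [Finset.mem_filter, Finset.mem_powerset] at hS ⊢
    exact ⟨by rw [hIcc]; exact Finset.map_subset_map.2 hS.1, (hcond S).1 hS.2⟩
  · intro S _ T _ h
    exact Finset.map_injective _ h
  · intro S hS
    rw [Finset.mem_filter, Finset.mem_powerset, hIcc, Finset.subset_map_iff] at hS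
    obtain ⟨⟨T, hT, rfl⟩, h⟩ := hS
    exact ⟨T, by rw [Finset.mem_filter, Finset.mem_powerset]; exact ⟨hT, (hcond T).2 h⟩, rfl⟩

open Complex MeasureTheory in
lemma integral_Icc_exp_two_pi_int (n : ℤ) :
    ∫ x in Set.Icc (-1 / 2 : ℝ) (1 / 2), Complex.exp (2 * Real.pi * n * I * x) =
      if n = 0 then 1 else 0 := by
  rw [integral_Icc_eq_integral_Ioc, ← intervalIntegral.integral_of_le (by norm_num)]
  split_ifs with h
  · simp [h]; norm_num
  · have hne : (2 * Real.pi * n * I : ℂ) ≠ 0 := by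
      simp [h, Real.pi_ne_zero]
    rw [integral_exp_mul_complex hne, div_eq_zero_iff, sub_eq_zero]
    left
    rw [Complex.exp_eq_exp_iff_exists_int]
    exact ⟨n, by push_cast; ring⟩

open Complex MeasureTheory in
lemma integral_torusBox_prod_exp (n : Fin 3 → ℤ) :
    ∫ v in torusBox, ∏ k, Complex.exp (2 * Real.pi * n k * I * v k) =
      if ∀ k, n k = 0 then 1 else 0 := by
  rw [torusBox, volume_pi, Measure.restrict_pi_pi,
    integral_fintype_prod_eq_prod (fun k (x : ℝ) => Complex.exp (2 * Real.pi * n k * I * x))]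
  simp only [integral_Icc_exp_two_pi_int]
  rw [Finset.prod_ite_zero]
  simp

lemma sum_range_quadPhase (v : Fin 3 → ℝ) (M : ℕ) : ∑ i ∈ Finset.range M, quadPhase v i =
    v 0 * M + v 1 * (M * (M - 1) / 2) + v 2 * (M * (M - 1) * (M - 2) / 6) := by
  induction M with
  | zero => simp
  | succ M ih => rw [Finset.sum_range_succ, ih]; simp only [quadPhase]; push_cast; ring

open Complex MeasureTheory in
/-- Expansion of the product of characteristic functions over subsets. -/
lemma prod_bernoulliChar_quadPhase {N c : ℕ} (hN : 0 < N) (hc : N ^ 3 = N + 6 * c)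
    (v : Fin 3 → ℝ) :
    ∏ i ∈ Finset.range (N ^ 2), bernoulliChar (1 / N) (2 * Real.pi * quadPhase v i) =
      ∑ S ∈ (Finset.range (N ^ 2)).powerset,
        ((1 / N : ℝ) ^ S.card * (1 - 1 / N : ℝ) ^ (N ^ 2 - S.card) : ℝ) *
          ∏ k, Complex.exp (2 * Real.pi * ((![(S.card : ℤ) - N, ∑ i ∈ S, (i : ℤ) - 3 * c,
            ∑ i ∈ S, (i.choose 2 : ℤ) + 2 * c - c * N ^ 2] k : ℤ) : ℂ) * I * v k) := by
  have hN' : (N : ℝ) ≠ 0 := by positivity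
  have hc' : (N : ℝ) ^ 3 = N + 6 * c := by exact_mod_cast hc
  have hcN : (c : ℝ) = (N ^ 3 - N) / 6 := by linarith
  simp only [bernoulliChar]
  rw [Finset.prod_mul_distrib]
  simp_rw [add_comm ((1 - 1 / (N : ℝ) : ℝ) : ℂ)]
  rw [Finset.prod_add, ← Complex.exp_sum, Finset.sum_mul]
  refine Finset.sum_congr rfl fun S hS => ?_
  rw [Finset.mem_powerset] at hS
  rw [Finset.prod_mul_distrib, ← Complex.exp_sum, Finset.prod_const, Finset.prod_const,
    Finset.card_sdiff_of_subset hS, Finset.card_range, ← Complex.exp_sum]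
  push_cast
  have key : ∀ a b x y z : ℂ, x + y = z → a * cexp x * b * cexp y = a * b * cexp z := by
    rintro a b x y z rfl
    rw [Complex.exp_add]; ring
  refine key _ _ _ _ _ ?_
  have e1 : ∑ i ∈ S, ((2 * Real.pi * quadPhase v i : ℝ) : ℂ) * I =
      ((2 * Real.pi * (v 0 * S.card + v 1 * ∑ i ∈ S, (i : ℝ) +
        v 2 * ∑ i ∈ S, (i.choose 2 : ℝ)) : ℝ) : ℂ) * I := by
    rw [← Finset.sum_mul, ← Complex.ofReal_sum]
    congr 2
    simp only [quadPhase, Nat.cast_choose_two, ← Finset.mul_sum, Finset.sum_add_distrib,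
      Finset.sum_const, nsmul_eq_mul]
    ring
  have e2 : ∑ i ∈ Finset.range (N ^ 2),
      (-(1 / N * (2 * Real.pi * quadPhase v i) : ℝ) : ℂ) * I =
      -((2 * Real.pi * (v 0 * N + v 1 * (3 * c) + v 2 * (c * N ^ 2 - 2 * c)) : ℝ) : ℂ) * I := by
    rw [← Finset.sum_mul, Finset.sum_neg_distrib, ← Complex.ofReal_sum, ← Finset.mul_sum,
      ← Finset.mul_sum, sum_range_quadPhase, hcN]
    congr 3
    push_cast
    field_simp
    ring
  push_cast at e1 e2
  rw [e1, e2, Fin.sum_univ_three]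
  simp
  ring

open Complex MeasureTheory in
/-- Fourier inversion: the number of bimagic series as an integral over the torus. -/
lemma bimagicSquareSeries_mul_eq_integral {N : ℕ} (hN : 0 < N) :
    (bimagicSquareSeries N : ℂ) * ((1 / N : ℝ) ^ N * (1 - 1 / N : ℝ) ^ (N ^ 2 - N) : ℝ) =
      ∫ v in torusBox, ∏ i ∈ Finset.range (N ^ 2),
        bernoulliChar (1 / N) (2 * Real.pi * quadPhase v i) := by
  obtain ⟨c, hc⟩ := exists_cube_eq_add_six_mul N
  simp_rw [prod_bernoulliChar_quadPhase hN hc]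
  rw [integral_finsetSum]
  · simp_rw [integral_const_mul, integral_torusBox_prod_exp]
    rw [bimagicSquareSeries_eq_card hc, Finset.card_eq_sum_ones, Nat.cast_sum, Finset.sum_filter,
      Finset.sum_mul]
    refine Finset.sum_congr rfl fun S _ => ?_
    have hiff : (∀ k, ![(S.card : ℤ) - N, ∑ i ∈ S, (i : ℤ) - 3 * c,
        ∑ i ∈ S, (i.choose 2 : ℤ) + 2 * c - c * N ^ 2] k = 0) ↔
        (S.card = N ∧ ∑ i ∈ S, i = 3 * c ∧ ∑ i ∈ S, i.choose 2 + 2 * c = c * N ^ 2) := by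
      rw [Fin.forall_fin_succ, Fin.forall_fin_succ, Fin.forall_fin_succ]
      simp only [Matrix.cons_val_zero, Matrix.cons_val_succ, IsEmpty.forall_iff, and_true]
      refine and_congr (by omega) (and_congr (by zify; exact sub_eq_zero) ?_)
      zify
      exact sub_eq_zero
    by_cases h : S.card = N ∧ ∑ i ∈ S, i = 3 * c ∧ ∑ i ∈ S, i.choose 2 + 2 * c = c * N ^ 2
    · rw [if_pos h, if_pos (hiff.2 h), h.1]; simp
    · rw [if_neg h, if_neg (mt hiff.1 h)]; simp
  · intro S _
    refine Integrable.const_mul ?_ _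
    have hcomp : IsCompact torusBox := isCompact_univ_pi fun _ => isCompact_Icc
    exact ContinuousOn.integrableOn_compact hcomp (by fun_prop)

lemma norm_bernoulliChar_le (p θ : ℝ) :
    ‖bernoulliChar p θ‖ ≤ Real.exp (-(2 * p * (1 - p) * Real.sin (θ / 2) ^ 2)) := by
  have h1 : ‖bernoulliChar p θ‖ = ‖((1 - p : ℝ) + p * Complex.exp (θ * Complex.I) : ℂ)‖ := by
    rw [bernoulliChar, norm_mul, ← Complex.ofReal_neg, Complex.norm_exp_ofReal_mul_I, mul_one]
  have h2 : ‖bernoulliChar p θ‖ ^ 2 = 1 - 4 * p * (1 - p) * Real.sin (θ / 2) ^ 2 := by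
    have hre : ((1 - p : ℝ) + p * Complex.exp (θ * Complex.I) : ℂ).re = 1 - p + p * Real.cos θ := by
      simp [Complex.exp_ofReal_mul_I_re]
    have him : ((1 - p : ℝ) + p * Complex.exp (θ * Complex.I) : ℂ).im = p * Real.sin θ := by
      simp [Complex.exp_ofReal_mul_I_im]
    rw [h1, Complex.sq_norm, Complex.normSq_apply, hre, him]
    have h3 : Real.cos θ = 1 - 2 * Real.sin (θ / 2) ^ 2 := by
      have := Real.cos_two_mul' (θ / 2)
      rw [mul_div_cancel₀ θ two_ne_zero] at this
      linarith [Real.sin_sq_add_cos_sq (θ / 2)]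
    have h4 := Real.sin_sq_add_cos_sq θ
    have h5 : (1 - p + p * Real.cos θ) * (1 - p + p * Real.cos θ) +
        p * Real.sin θ * (p * Real.sin θ) = 1 - 2 * p * (1 - p) * (1 - Real.cos θ) := by
      linear_combination p ^ 2 * h4
    rw [h5, h3]; ring
  refine le_of_sq_le_sq ?_ (Real.exp_pos _).le
  rw [h2, ← Real.exp_nat_mul]
  refine le_trans ?_ (Real.add_one_le_exp _)
  push_cast
  linarith

lemma abs_cos_sub_le {θ : ℝ} (hθ : |θ| ≤ 1) :
    |Real.cos θ - (1 - θ ^ 2 / 2 + θ ^ 4 / 24)| ≤ |θ| ^ 6 / 4 ∧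
      |Real.sin θ - (θ - θ ^ 3 / 6 + θ ^ 5 / 120)| ≤ |θ| ^ 6 / 4 := by
  have hn : ‖(θ * Complex.I : ℂ)‖ = |θ| := by simp
  have hb := Complex.exp_bound (x := θ * Complex.I) (by rw [hn]; exact hθ) (n := 6) (by norm_num)
  rw [hn] at hb
  have hI3 : Complex.I ^ 3 = -Complex.I := by rw [pow_succ, Complex.I_sq]; ring
  have hI5 : Complex.I ^ 5 = Complex.I := by 
    rw [show (5 : ℕ) = 4 + 1 from rfl, pow_succ, Complex.I_pow_four, one_mul]
  have hs : Complex.exp (θ * Complex.I) -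
      ∑ m ∈ Finset.range 6, (θ * Complex.I : ℂ) ^ m / (m.factorial : ℂ) =
      ((Real.cos θ - (1 - θ ^ 2 / 2 + θ ^ 4 / 24) : ℝ) : ℂ) +
        ((Real.sin θ - (θ - θ ^ 3 / 6 + θ ^ 5 / 120) : ℝ) : ℂ) * Complex.I := by
    rw [Complex.exp_mul_I]
    simp [Finset.sum_range_succ, Nat.factorial, mul_pow, hI3, hI5, Complex.I_pow_four]
    ring
  rw [hs] at hb
  have hle : |θ| ^ 6 * ((Nat.succ 6 : ℝ) * ((Nat.factorial 6 : ℝ) * (6 : ℕ))⁻¹) ≤ |θ| ^ 6 / 4 := by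
    rw [div_eq_mul_inv]
    gcongr
    norm_num [Nat.factorial]
  constructor
  · have := (Complex.abs_re_le_norm _).trans (hb.trans hle)
    rwa [Complex.add_re, Complex.ofReal_re, Complex.re_ofReal_mul, Complex.I_re, mul_zero,
      add_zero] at this
  · have := (Complex.abs_im_le_norm _).trans (hb.trans hle)
    rwa [Complex.add_im, Complex.ofReal_im, Complex.im_ofReal_mul, Complex.I_im, mul_one,
      zero_add] at this

/-- Local expansion of the logarithm of the characteristic function. -/
lemma exists_bernoulliChar_eq_exp {p θ : ℝ} (hp0 : 0 ≤ p) (hp1 : p ≤ 1 / 2) (hθ : |θ| ≤ 1 / 2) :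
    ∃ l : ℂ, bernoulliChar p θ = Complex.exp (-(p * θ ^ 2 / 2 : ℝ) + l) ∧
      |l.re - (p * θ ^ 4 / 24 + p ^ 2 * θ ^ 2 / 2)| ≤
        p * θ ^ 6 / 4 + p ^ 2 * θ ^ 4 + p ^ 3 * |θ| ^ 3 ∧
      |l.im + p * θ ^ 3 / 6| ≤ p * |θ| ^ 5 + p ^ 2 * |θ| ^ 3 := by
  set c := Real.cos θ with hc
  set s := Real.sin θ with hs
  set w : ℂ := p * (Complex.exp (θ * Complex.I) - 1) with hw
  have hE : ‖Complex.exp (θ * Complex.I) - 1‖ ≤ |θ| := by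
    rw [mul_comm]; exact Real.norm_exp_I_mul_ofReal_sub_one_le
  have hwn : ‖w‖ ≤ p * |θ| := by
    rw [hw, norm_mul, Complex.norm_real, Real.norm_of_nonneg hp0]
    gcongr
  have hw4 : ‖w‖ ≤ 1 / 4 := by nlinarith [abs_nonneg θ]
  have hre : w.re = p * (c - 1) := by simp [hw, Complex.exp_ofReal_mul_I_re, hc]
  have him : w.im = p * s := by simp [hw, Complex.exp_ofReal_mul_I_im, hs]
  have hlog : ‖Complex.log (1 + w) - (w - w ^ 2 / 2)‖ ≤ p ^ 3 * |θ| ^ 3 / 2 := by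
    have h := Complex.norm_log_sub_logTaylor_le 2 (z := w) (by linarith)
    have ht : Complex.logTaylor (2 + 1) w = w - w ^ 2 / 2 := by
      simp [Complex.logTaylor, Finset.sum_range_succ]; ring
    rw [ht] at h
    refine h.trans ?_
    have h1 : (1 - ‖w‖)⁻¹ ≤ 4 / 3 := by
      rw [inv_le_comm₀ (by linarith) (by norm_num)]; linarith
    have h2 : ‖w‖ ^ 3 ≤ p ^ 3 * |θ| ^ 3 := by
      rw [← mul_pow]; exact pow_le_pow_left₀ (norm_nonneg _) hwn 3
    have h3 : (0 : ℝ) ≤ ‖w‖ ^ 3 := by positivity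
    have h4 : ‖w‖ ^ 3 * (1 - ‖w‖)⁻¹ ≤ ‖w‖ ^ 3 * (4 / 3) := by gcongr
    norm_num
    linarith
  have hne : 1 + w ≠ 0 := by
    intro h
    have : ‖w‖ = 1 := by rw [show w = -1 by linear_combination h]; simp
    linarith
  obtain ⟨hcb, hsb⟩ := abs_cos_sub_le (θ := θ) (by linarith)
  rw [← hc] at hcb
  rw [← hs] at hsb
  set e : ℂ := Complex.log (1 + w) - (w - w ^ 2 / 2) with he
  have her := (Complex.abs_re_le_norm e).trans hlog
  have hei := (Complex.abs_im_le_norm e).trans hlog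
  have hlogre : (Complex.log (1 + w)).re =
      p * (c - 1) - p ^ 2 * ((c - 1) ^ 2 - s ^ 2) / 2 + e.re := by
    have : Complex.log (1 + w) = w - w * w / 2 + e := by rw [he]; ring
    rw [this]; simp [hre, him]; ring
  have hlogim : (Complex.log (1 + w)).im =
      p * s - p ^ 2 * (c - 1) * s + e.im := by
    have : Complex.log (1 + w) = w - w * w / 2 + e := by rw [he]; ring
    rw [this]; simp [hre, him]; ring
  have hc1 : |c - 1| ≤ θ ^ 2 / 2 := by
    rw [abs_le]
    constructor <;> linarith [Real.one_sub_sq_div_two_le_cos (x := θ), Real.cos_le_one θ,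
      sq_nonneg θ]
  have hs1 : |s| ≤ |θ| := Real.abs_sin_le_abs
  have hsθ : |s ^ 2 - θ ^ 2| ≤ θ ^ 4 := by
    have h5 := Real.sin_bound (x := θ) (by linarith)
    rw [← hs] at h5
    have h6 : |s - θ| ≤ |θ| ^ 3 / 2 := by
      calc |s - θ| = |(s - (θ - θ ^ 3 / 6)) + (-(θ ^ 3 / 6))| := by ring_nf
        _ ≤ |θ| ^ 5 / 100 + |θ| ^ 3 / 6 := by
          refine (abs_add_le _ _).trans ?_
          gcongr
          rw [abs_neg, abs_div, abs_pow]; norm_num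
        _ ≤ _ := by
          have : |θ| ^ 5 ≤ |θ| ^ 3 :=
            pow_le_pow_of_le_one (abs_nonneg _) (by linarith) (by norm_num)
          have : 0 ≤ |θ| ^ 3 := by positivity
          linarith
    calc |s ^ 2 - θ ^ 2| = |s - θ| * |s + θ| := by rw [← abs_mul]; ring_nf
      _ ≤ |θ| ^ 3 / 2 * (|θ| + |θ|) := by
        gcongr
        exact (abs_add_le _ _).trans (by gcongr)
      _ = |θ| ^ 4 := by ring
      _ = _ := Even.pow_abs (by decide) θ
  refine ⟨Complex.log (1 + w) - (p * θ : ℝ) * Complex.I + (p * θ ^ 2 / 2 : ℝ), ?_, ?_, ?_⟩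
  · rw [show (-((p * θ ^ 2 / 2 : ℝ) : ℂ) + (Complex.log (1 + w) - ((p * θ : ℝ) : ℂ) * Complex.I +
      ((p * θ ^ 2 / 2 : ℝ) : ℂ))) = Complex.log (1 + w) + -((p * θ : ℝ) : ℂ) * Complex.I by ring,
      Complex.exp_add, Complex.exp_log hne, bernoulliChar, hw]
    push_cast
    ring
  · have hR : (Complex.log (1 + w) - ((p * θ : ℝ) : ℂ) * Complex.I +
        ((p * θ ^ 2 / 2 : ℝ) : ℂ)).re - (p * θ ^ 4 / 24 + p ^ 2 * θ ^ 2 / 2) =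
        p * (c - (1 - θ ^ 2 / 2 + θ ^ 4 / 24)) + p ^ 2 / 2 * (s ^ 2 - θ ^ 2) -
          p ^ 2 / 2 * (c - 1) ^ 2 + e.re := by
      simp only [Complex.add_re, Complex.sub_re, Complex.re_ofReal_mul, Complex.I_re, mul_zero,
        Complex.ofReal_re, hlogre]
      ring
    rw [hR]
    have a1 : |p * (c - (1 - θ ^ 2 / 2 + θ ^ 4 / 24))| ≤ p * θ ^ 6 / 4 := by
      rw [abs_mul, abs_of_nonneg hp0, ← Even.pow_abs (by decide : Even 6) θ, mul_div_assoc]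
      gcongr
    have a2 : |p ^ 2 / 2 * (s ^ 2 - θ ^ 2)| ≤ p ^ 2 / 2 * θ ^ 4 := by
      rw [abs_mul, abs_of_nonneg (by positivity)]; gcongr
    have a3 : |p ^ 2 / 2 * (c - 1) ^ 2| ≤ p ^ 2 / 2 * (θ ^ 2 / 2) ^ 2 := by
      rw [abs_mul, abs_of_nonneg (by positivity : 0 ≤ p ^ 2 / 2), abs_pow]; gcongr
    have a4 : 0 ≤ p ^ 3 * |θ| ^ 3 := by positivity
    have a5 : 0 ≤ p ^ 2 * θ ^ 4 := by positivity
    refine (abs_add_le _ _).trans ?_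
    refine (add_le_add_left (abs_sub _ _) _).trans ?_
    have a6 := abs_add_le (p * (c - (1 - θ ^ 2 / 2 + θ ^ 4 / 24))) (p ^ 2 / 2 * (s ^ 2 - θ ^ 2))
    nlinarith
  · have hR : (Complex.log (1 + w) - ((p * θ : ℝ) : ℂ) * Complex.I +
        ((p * θ ^ 2 / 2 : ℝ) : ℂ)).im + p * θ ^ 3 / 6 =
        p * (s - (θ - θ ^ 3 / 6 + θ ^ 5 / 120)) + p * (θ ^ 5 / 120) -
          p ^ 2 * (c - 1) * s + e.im := by
      simp only [Complex.add_im, Complex.sub_im, Complex.im_ofReal_mul, Complex.I_im, mul_one,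
        Complex.ofReal_im, hlogim]
      ring
    rw [hR]
    have h65 : |θ| ^ 6 ≤ |θ| ^ 5 :=
      pow_le_pow_of_le_one (abs_nonneg _) (by linarith) (by norm_num)
    have a1 : |p * (s - (θ - θ ^ 3 / 6 + θ ^ 5 / 120))| ≤ p * (|θ| ^ 5 / 4) := by
      rw [abs_mul, abs_of_nonneg hp0]
      gcongr
      exact hsb.trans (by linarith)
    have a2 : |p * (θ ^ 5 / 120)| = p * (|θ| ^ 5 / 120) := by
      rw [abs_mul, abs_of_nonneg hp0, abs_div, abs_pow]; norm_num
    have a3 : |p ^ 2 * (c - 1) * s| ≤ p ^ 2 * (θ ^ 2 / 2) * |θ| := by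
      rw [abs_mul, abs_mul, abs_of_nonneg (by positivity : 0 ≤ p ^ 2)]; gcongr
    have a3' : p ^ 2 * (θ ^ 2 / 2) * |θ| = p ^ 2 * |θ| ^ 3 / 2 := by rw [← sq_abs θ]; ring
    have a4 : p ^ 3 * |θ| ^ 3 ≤ p ^ 2 * |θ| ^ 3 := by
      exact mul_le_mul_of_nonneg_right
        (pow_le_pow_of_le_one hp0 (by linarith) (by norm_num)) (by positivity)
    have a5 : 0 ≤ p * |θ| ^ 5 := by positivity
    refine (abs_add_le _ _).trans ?_
    have a6 := abs_sub (p * (s - (θ - θ ^ 3 / 6 + θ ^ 5 / 120)) + p * (θ ^ 5 / 120))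
      (p ^ 2 * (c - 1) * s)
    have a7 := abs_add_le (p * (s - (θ - θ ^ 3 / 6 + θ ^ 5 / 120))) (p * (θ ^ 5 / 120))
    linarith

open MeasureTheory in
/-- Left Riemann sums of a Lipschitz function. -/
lemma abs_riemannSum_sub_integral_le {h : ℝ → ℝ} {K : ℝ} (hc : Continuous h)
    (hK : ∀ s ∈ Set.Icc (0 : ℝ) 1, ∀ t ∈ Set.Icc (0 : ℝ) 1, |h s - h t| ≤ K * |s - t|)
    {M : ℕ} (hM : 0 < M) :
    |(∑ i ∈ Finset.range M, h (i / M)) / M - ∫ t in (0 : ℝ)..1, h t| ≤ K / M := by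
  have hM' : (0 : ℝ) < M := by exact_mod_cast hM
  have hK0 : 0 ≤ K := by
    have := hK 0 (by simp) 1 (by simp)
    simp at this
    exact (abs_nonneg _).trans this
  have hsplit : ∫ t in (0 : ℝ)..1, h t =
      ∑ i ∈ Finset.range M, ∫ t in ((i : ℝ) / M)..((i + 1 : ℕ) : ℝ) / M, h t := by
    rw [intervalIntegral.sum_integral_adjacent_intervals (a := fun i : ℕ => (i : ℝ) / M)
      fun k _ => hc.intervalIntegrable _ _]
    simp [hM'.ne']
  rw [hsplit, Finset.sum_div, ← Finset.sum_sub_distrib]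
  refine (Finset.abs_sum_le_sum_abs _ _).trans ?_
  have hterm : ∀ i ∈ Finset.range M,
      |h (i / M) / M - ∫ t in ((i : ℝ) / M)..((i + 1 : ℕ) : ℝ) / M, h t| ≤ K / M / M := by
    intro i hi
    have hi' : (i : ℝ) + 1 ≤ M := by exact_mod_cast Finset.mem_range.1 hi
    have hlen : ((i + 1 : ℕ) : ℝ) / M - i / M = 1 / M := by push_cast; ring
    have hlt : (i : ℝ) / M ≤ ((i + 1 : ℕ) : ℝ) / M := by
      have : (0 : ℝ) ≤ 1 / M := by positivity
      linarith
    have hconst : h (i / M) / M = ∫ t in ((i : ℝ) / M)..((i + 1 : ℕ) : ℝ) / M, h (i / M) := by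
      rw [intervalIntegral.integral_const, hlen, smul_eq_mul]; ring
    rw [hconst, ← intervalIntegral.integral_sub (by simp) (hc.intervalIntegrable _ _),
      ← Real.norm_eq_abs]
    have := intervalIntegral.norm_integral_le_of_norm_le_const (a := (i : ℝ) / M)
      (b := ((i + 1 : ℕ) : ℝ) / M) (f := fun t => h (i / M) - h t) (C := K / M) ?_
    · rwa [hlen, abs_of_pos (by positivity), mul_one_div] at this
    · intro t ht
      rw [Set.uIoc_of_le hlt] at ht
      have h1 : ((i + 1 : ℕ) : ℝ) / M ≤ 1 := by
        rw [div_le_one hM']; push_cast; exact hi'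
      have h0 : (0 : ℝ) ≤ i / M := by positivity
      refine (hK _ ⟨h0, by linarith⟩ t ⟨by linarith [ht.1], by linarith [ht.2]⟩).trans ?_
      rw [show K / M = K * (1 / M) by ring]
      gcongr
      rw [abs_sub_comm, abs_of_nonneg (by linarith [ht.1])]
      linarith [ht.2]
  refine (Finset.sum_le_sum hterm).trans ?_
  rw [Finset.sum_const, Finset.card_range, nsmul_eq_mul]
  field_simp
  rfl

/-- The quadratic polynomial on `[0, 1]` with coefficients `x` in the orthonormal basis of shifted
Legendre polynomials. -/
noncomputable def legendreProfile (x : Fin 3 → ℝ) (t : ℝ) : ℝ :=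
  x 0 + x 1 * (√3 * (2 * t - 1)) + x 2 * (√5 * (6 * t ^ 2 - 6 * t + 1))

/-- `√(1 + |x|²)`. -/
noncomputable def japaneseNorm (x : Fin 3 → ℝ) : ℝ := √(1 + ∑ k, x k ^ 2)

lemma japaneseNorm_sq (x : Fin 3 → ℝ) : japaneseNorm x ^ 2 = 1 + ∑ k, x k ^ 2 :=
  Real.sq_sqrt (by positivity)

lemma one_le_japaneseNorm (x : Fin 3 → ℝ) : 1 ≤ japaneseNorm x := by
  rw [japaneseNorm, Real.one_le_sqrt]
  have : 0 ≤ ∑ k, x k ^ 2 := by positivity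
  linarith

lemma abs_legendreProfile_le (x : Fin 3 → ℝ) {t : ℝ} (ht : t ∈ Set.Icc (0 : ℝ) 1) :
    |legendreProfile x t| ≤ 3 * japaneseNorm x := by
  have h0 := one_le_japaneseNorm x
  refine abs_le_of_sq_le_sq ?_ (by positivity)
  rw [mul_pow, japaneseNorm_sq, Fin.sum_univ_three, legendreProfile]
  have ha : (√3 * (2 * t - 1)) ^ 2 ≤ 3 := by
    rw [mul_pow, Real.sq_sqrt (by norm_num)]; nlinarith [ht.1, ht.2]
  have hb : (√5 * (6 * t ^ 2 - 6 * t + 1)) ^ 2 ≤ 5 := by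
    rw [mul_pow, Real.sq_sqrt (by norm_num)]
    have h1 : 0 ≤ t * (1 - t) := mul_nonneg ht.1 (by linarith [ht.2])
    have h2 : t * (1 - t) ≤ 1 / 4 := by nlinarith [sq_nonneg (t - 1 / 2)]
    nlinarith
  set a := √3 * (2 * t - 1)
  set b := √5 * (6 * t ^ 2 - 6 * t + 1)
  have hcs : (x 0 + x 1 * a + x 2 * b) ^ 2 ≤
      (x 0 ^ 2 + x 1 ^ 2 + x 2 ^ 2) * (1 + a ^ 2 + b ^ 2) := by
    nlinarith [sq_nonneg (x 0 * a - x 1), sq_nonneg (x 0 * b - x 2),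
      sq_nonneg (x 1 * b - x 2 * a)]
  have h9 : (x 0 ^ 2 + x 1 ^ 2 + x 2 ^ 2) * (1 + a ^ 2 + b ^ 2) ≤
      (x 0 ^ 2 + x 1 ^ 2 + x 2 ^ 2) * 9 := by gcongr; linarith
  linarith

lemma abs_legendreProfile_sub_le (x : Fin 3 → ℝ) {s t : ℝ} (hs : s ∈ Set.Icc (0 : ℝ) 1)
    (ht : t ∈ Set.Icc (0 : ℝ) 1) :
    |legendreProfile x s - legendreProfile x t| ≤ 14 * japaneseNorm x * |s - t| := by
  have h0 := one_le_japaneseNorm x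
  have e : legendreProfile x s - legendreProfile x t =
      (x 1 * (√3 * 2) + x 2 * (√5 * (6 * (s + t - 1)))) * (s - t) := by
    simp only [legendreProfile]; ring
  rw [e, abs_mul]
  gcongr
  refine abs_le_of_sq_le_sq ?_ (by positivity)
  rw [mul_pow, japaneseNorm_sq, Fin.sum_univ_three]
  have ha : (√3 * 2) ^ 2 = 12 := by
    rw [mul_pow, Real.sq_sqrt (by norm_num)]; norm_num
  have hb : (√5 * (6 * (s + t - 1))) ^ 2 ≤ 180 := by
    rw [mul_pow, Real.sq_sqrt (by norm_num)]
    nlinarith [ht.1, ht.2, hs.1, hs.2]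
  set a := √3 * 2
  set b := √5 * (6 * (s + t - 1))
  have hcs : (x 1 * a + x 2 * b) ^ 2 ≤ (x 1 ^ 2 + x 2 ^ 2) * (a ^ 2 + b ^ 2) := by
    nlinarith [sq_nonneg (x 1 * b - x 2 * a)]
  have h9 : (x 1 ^ 2 + x 2 ^ 2) * (a ^ 2 + b ^ 2) ≤ (x 1 ^ 2 + x 2 ^ 2) * 192 := by
    gcongr; linarith
  nlinarith [sq_nonneg (x 0), sq_nonneg (x 1), sq_nonneg (x 2)]

lemma continuous_legendreProfile (x : Fin 3 → ℝ) : Continuous (legendreProfile x) := by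
  unfold legendreProfile; fun_prop

/-- The average of the `k`-th power of the profile over the `M` equally spaced nodes. -/
noncomputable def profileMean (M k : ℕ) (x : Fin 3 → ℝ) : ℝ :=
  (∑ i ∈ Finset.range M, legendreProfile x (i / M) ^ k) / M

lemma abs_pow_sub_pow_le_of_abs_le {a b B : ℝ} (ha : |a| ≤ B) (hb : |b| ≤ B) (k : ℕ) :
    |a ^ k - b ^ k| ≤ k * B ^ (k - 1) * |a - b| := by
  have hB : 0 ≤ B := (abs_nonneg a).trans ha
  refine (abs_pow_sub_pow_le a b k).trans ?_
  rw [mul_comm (|a - b|), mul_assoc, mul_assoc]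
  have : max |a| |b| ^ (k - 1) ≤ B ^ (k - 1) := by
    gcongr
    exact max_le ha hb
  have h2 := mul_le_mul_of_nonneg_left this (Nat.cast_nonneg (α := ℝ) k)
  nlinarith [mul_le_mul_of_nonneg_right h2 (abs_nonneg (a - b))]

open MeasureTheory in
lemma abs_profileMean_sub_integral_le (x : Fin 3 → ℝ) (k : ℕ) {M : ℕ} (hM : 0 < M) :
    |profileMean M k x - ∫ t in (0 : ℝ)..1, legendreProfile x t ^ k| ≤
      k * (3 * japaneseNorm x) ^ (k - 1) * (14 * japaneseNorm x) / M := by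
  refine abs_riemannSum_sub_integral_le ((continuous_legendreProfile x).pow k) ?_ hM
  intro s hs t ht
  refine (abs_pow_sub_pow_le_of_abs_le (abs_legendreProfile_le x hs)
    (abs_legendreProfile_le x ht) k).trans ?_
  rw [mul_assoc _ _ |s - t|]
  have h0 := one_le_japaneseNorm x
  gcongr
  exact abs_legendreProfile_sub_le x hs ht

lemma tendsto_profileMean (x : Fin 3 → ℝ) (k : ℕ) :
    Tendsto (fun N : ℕ => profileMean (N ^ 2) k x) atTop
      (nhds (∫ t in (0 : ℝ)..1, legendreProfile x t ^ k)) := by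
  rw [tendsto_iff_norm_sub_tendsto_zero]
  set C := k * (3 * japaneseNorm x) ^ (k - 1) * (14 * japaneseNorm x)
  have hC : Tendsto (fun N : ℕ => C / ((N ^ 2 : ℕ) : ℝ)) atTop (nhds 0) :=
    (tendsto_const_div_atTop_nhds_zero_nat C).comp (tendsto_pow_atTop two_ne_zero)
  refine squeeze_zero' (Eventually.of_forall fun _ => norm_nonneg _) ?_ hC
  filter_upwards [eventually_gt_atTop 0] with N hN
  exact abs_profileMean_sub_integral_le x k (pow_pos hN 2)

lemma natCast_div_mem_Icc {i M : ℕ} (hi : i ∈ Finset.range M) :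
    (i / M : ℝ) ∈ Set.Icc (0 : ℝ) 1 := by
  have h : (i : ℝ) ≤ M := by exact_mod_cast (Finset.mem_range.1 hi).le
  exact ⟨by positivity, div_le_one_of_le₀ h (by positivity)⟩

lemma sum_abs_legendreProfile_pow_le (x : Fin 3 → ℝ) (M k : ℕ) :
    ∑ i ∈ Finset.range M, |legendreProfile x (i / M)| ^ k ≤ M * (3 * japaneseNorm x) ^ k := by
  refine (Finset.sum_le_sum fun i hi => pow_le_pow_left₀ (abs_nonneg _)
    (abs_legendreProfile_le x (natCast_div_mem_Icc hi)) k).trans ?_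
  simp

lemma abs_profileMean_le (x : Fin 3 → ℝ) {M : ℕ} (k : ℕ) (hM : 0 < M) :
    |profileMean M k x| ≤ (3 * japaneseNorm x) ^ k := by
  have hM' : (0 : ℝ) < M := by exact_mod_cast hM
  rw [profileMean, abs_div, Nat.abs_cast, div_le_iff₀ hM', mul_comm]
  refine (Finset.abs_sum_le_sum_abs _ _).trans ((Finset.sum_le_sum fun i _ => ?_).trans
    (sum_abs_legendreProfile_pow_le x M k))
  exact (abs_pow _ _).le

lemma legendreProfile_eq (x : Fin 3 → ℝ) (t : ℝ) : legendreProfile x t =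
    x 0 - √3 * x 1 + √5 * x 2 + (2 * (√3 * x 1) - 6 * (√5 * x 2)) * t +
      6 * (√5 * x 2) * t ^ 2 := by
  simp only [legendreProfile]; ring

open intervalIntegral in
lemma integral_legendreProfile_sq (x : Fin 3 → ℝ) :
    ∫ t in (0 : ℝ)..1, legendreProfile x t ^ 2 = ∑ k, x k ^ 2 := by
  have h : ∀ t, HasDerivAt (fun t : ℝ =>
      (fun a b c : ℝ => t * a ^ 2 + t ^ 2 * (a * b) + t ^ 3 * ((b ^ 2 + 2 * a * c) / 3) +
        t ^ 4 * (b * c / 2) + t ^ 5 * (c ^ 2 / 5)) (x 0 - √3 * x 1 + √5 * x 2)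
        (2 * (√3 * x 1) - 6 * (√5 * x 2)) (6 * (√5 * x 2))) (legendreProfile x t ^ 2) t := by
    intro t
    refine HasDerivAt.congr_deriv (((((hasDerivAt_id t).mul_const _).add
      ((hasDerivAt_pow 2 t).mul_const _)).add ((hasDerivAt_pow 3 t).mul_const _)).add
      ((hasDerivAt_pow 4 t).mul_const _) |>.add ((hasDerivAt_pow 5 t).mul_const _)) ?_
    rw [legendreProfile_eq]; push_cast; ring
  rw [integral_eq_sub_of_hasDerivAt (fun t _ => h t)
    (((continuous_legendreProfile x).pow 2).intervalIntegrable _ _), Fin.sum_univ_three]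
  have h3 : √3 ^ 2 = (3 : ℝ) := Real.sq_sqrt (by norm_num)
  have h5 : √5 ^ 2 = (5 : ℝ) := Real.sq_sqrt (by norm_num)
  linear_combination (x 1 ^ 2 / 3) * h3 + (x 2 ^ 2 / 5) * h5

open intervalIntegral in
lemma integral_legendreProfile_cube (x : Fin 3 → ℝ) :
    ∫ t in (0 : ℝ)..1, legendreProfile x t ^ 3 =
      x 0 ^ 3 + x 0 * (√3 * x 1) ^ 2 + 3 / 5 * (x 0 * (√5 * x 2) ^ 2) +
        2 / 5 * ((√3 * x 1) ^ 2 * (√5 * x 2)) + 2 / 35 * (√5 * x 2) ^ 3 := by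
  have h : ∀ t, HasDerivAt (fun t : ℝ =>
      (fun a b c : ℝ => t * a ^ 3 + t ^ 2 * (3 * a ^ 2 * b / 2) +
        t ^ 3 * (a ^ 2 * c + a * b ^ 2) + t ^ 4 * ((6 * a * b * c + b ^ 3) / 4) +
        t ^ 5 * ((3 * a * c ^ 2 + 3 * b ^ 2 * c) / 5) + t ^ 6 * (b * c ^ 2 / 2) +
        t ^ 7 * (c ^ 3 / 7)) (x 0 - √3 * x 1 + √5 * x 2)
        (2 * (√3 * x 1) - 6 * (√5 * x 2)) (6 * (√5 * x 2))) (legendreProfile x t ^ 3) t := by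
    intro t
    refine HasDerivAt.congr_deriv (((((hasDerivAt_id t).mul_const _).add
      ((hasDerivAt_pow 2 t).mul_const _)).add ((hasDerivAt_pow 3 t).mul_const _)).add
      ((hasDerivAt_pow 4 t).mul_const _) |>.add ((hasDerivAt_pow 5 t).mul_const _)
      |>.add ((hasDerivAt_pow 6 t).mul_const _) |>.add ((hasDerivAt_pow 7 t).mul_const _)) ?_
    rw [legendreProfile_eq]; push_cast; ring
  rw [integral_eq_sub_of_hasDerivAt (fun t _ => h t)
    (((continuous_legendreProfile x).pow 3).intervalIntegrable _ _)]
  ring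

open intervalIntegral in
lemma integral_legendreProfile_pow_four (x : Fin 3 → ℝ) :
    ∫ t in (0 : ℝ)..1, legendreProfile x t ^ 4 =
      x 0 ^ 4 + 2 * (x 0 ^ 2 * (√3 * x 1) ^ 2) + 6 / 5 * (x 0 ^ 2 * (√5 * x 2) ^ 2) +
        8 / 5 * (x 0 * (√3 * x 1) ^ 2 * (√5 * x 2)) + 8 / 35 * (x 0 * (√5 * x 2) ^ 3) +
        1 / 5 * (√3 * x 1) ^ 4 + 22 / 35 * ((√3 * x 1) ^ 2 * (√5 * x 2) ^ 2) +
        3 / 35 * (√5 * x 2) ^ 4 := by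
  have h : ∀ t, HasDerivAt (fun t : ℝ =>
      (fun a b c : ℝ => t * a ^ 4 + t ^ 2 * (2 * a ^ 3 * b) +
        t ^ 3 * ((4 * a ^ 3 * c + 6 * a ^ 2 * b ^ 2) / 3) +
        t ^ 4 * (3 * a ^ 2 * b * c + a * b ^ 3) +
        t ^ 5 * ((6 * a ^ 2 * c ^ 2 + 12 * a * b ^ 2 * c + b ^ 4) / 5) +
        t ^ 6 * ((12 * a * b * c ^ 2 + 4 * b ^ 3 * c) / 6) +
        t ^ 7 * ((4 * a * c ^ 3 + 6 * b ^ 2 * c ^ 2) / 7) + t ^ 8 * (b * c ^ 3 / 2) +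
        t ^ 9 * (c ^ 4 / 9)) (x 0 - √3 * x 1 + √5 * x 2)
        (2 * (√3 * x 1) - 6 * (√5 * x 2)) (6 * (√5 * x 2))) (legendreProfile x t ^ 4) t := by
    intro t
    refine HasDerivAt.congr_deriv (((((hasDerivAt_id t).mul_const _).add
      ((hasDerivAt_pow 2 t).mul_const _)).add ((hasDerivAt_pow 3 t).mul_const _)).add
      ((hasDerivAt_pow 4 t).mul_const _) |>.add ((hasDerivAt_pow 5 t).mul_const _)
      |>.add ((hasDerivAt_pow 6 t).mul_const _) |>.add ((hasDerivAt_pow 7 t).mul_const _)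
      |>.add ((hasDerivAt_pow 8 t).mul_const _) |>.add ((hasDerivAt_pow 9 t).mul_const _)) ?_
    rw [legendreProfile_eq]; push_cast; ring
  rw [integral_eq_sub_of_hasDerivAt (fun t _ => h t)
    (((continuous_legendreProfile x).pow 4).intervalIntegrable _ _)]
  ring

lemma exists_prod_bernoulliChar_eq_exp {p : ℝ} (hp0 : 0 ≤ p) (hp1 : p ≤ 1 / 2) {M : ℕ} {θ : ℕ → ℝ}
    (hθ : ∀ i ∈ Finset.range M, |θ i| ≤ 1 / 2) :
    ∃ L : ℂ, ∏ i ∈ Finset.range M, bernoulliChar p (θ i) =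
        Complex.exp (-(∑ i ∈ Finset.range M, p * θ i ^ 2 / 2 : ℝ) + L) ∧
      |L.re - ∑ i ∈ Finset.range M, (p * θ i ^ 4 / 24 + p ^ 2 * θ i ^ 2 / 2)| ≤
        ∑ i ∈ Finset.range M, (p * θ i ^ 6 / 4 + p ^ 2 * θ i ^ 4 + p ^ 3 * |θ i| ^ 3) ∧
      |L.im + ∑ i ∈ Finset.range M, p * θ i ^ 3 / 6| ≤
        ∑ i ∈ Finset.range M, (p * |θ i| ^ 5 + p ^ 2 * |θ i| ^ 3) := by
  choose! l hl hre him using fun i hi => exists_bernoulliChar_eq_exp hp0 hp1 (hθ i hi)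
  refine ⟨∑ i ∈ Finset.range M, l i, ?_, ?_, ?_⟩
  · rw [Finset.prod_congr rfl hl, ← Complex.exp_sum, Finset.sum_add_distrib]
    push_cast
    rw [Finset.sum_neg_distrib]
  · rw [Complex.re_sum, ← Finset.sum_sub_distrib]
    exact (Finset.abs_sum_le_sum_abs _ _).trans (Finset.sum_le_sum hre)
  · rw [Complex.im_sum, ← Finset.sum_add_distrib]
    exact (Finset.abs_sum_le_sum_abs _ _).trans (Finset.sum_le_sum him)

/-- The integrand of the Fourier representation in rescaled coordinates. -/
noncomputable def scaledProd (N : ℕ) (x : Fin 3 → ℝ) : ℂ :=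
  ∏ i ∈ Finset.range (N ^ 2),
    bernoulliChar (1 / N) (legendreProfile x (i / (N ^ 2 : ℕ)) / √N)

/-- The rescaled points at which all phases are small. -/
def smallPhaseSet (N : ℕ) : Set (Fin 3 → ℝ) :=
  {x | ∀ i ∈ Finset.range (N ^ 2), |legendreProfile x (i / (N ^ 2 : ℕ)) / √N| ≤ 1 / 2}

lemma small_phase_error_le {p θ : ℝ} (hp0 : 0 ≤ p) (hp1 : p ≤ 1 / 100) (hθ : |θ| ≤ 1 / 2) :
    p * θ ^ 4 / 24 + p ^ 2 * θ ^ 2 / 2 + (p * θ ^ 6 / 4 + p ^ 2 * θ ^ 4 + p ^ 3 * |θ| ^ 3) ≤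
      1 / 10 * (p * θ ^ 2 / 2) := by
  rw [← Even.pow_abs (by decide : Even 4) θ, ← Even.pow_abs (by decide : Even 6) θ,
    ← Even.pow_abs (by decide : Even 2) θ]
  obtain ⟨t, ht⟩ : ∃ t, |θ| = t := ⟨_, rfl⟩
  have h0 : 0 ≤ t := ht ▸ abs_nonneg θ
  rw [ht] at hθ ⊢
  have t1 : t ^ 2 ≤ 1 / 4 := by nlinarith
  have t2 : t ^ 4 ≤ 1 / 16 := by nlinarith [pow_nonneg h0 2]
  have p1 : p ^ 2 ≤ 1 / 10000 := by nlinarith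
  have h1 : p * t ^ 2 ≤ 1 / 100 * (1 / 4) := by gcongr
  have h2 : p ^ 2 * t ≤ 1 / 10000 * (1 / 2) := by gcongr
  have key : t ^ 2 / 24 + p / 2 + (t ^ 4 / 4 + p * t ^ 2 + p ^ 2 * t) ≤ 1 / 20 := by linarith
  calc _ = p * t ^ 2 * (t ^ 2 / 24 + p / 2 + (t ^ 4 / 4 + p * t ^ 2 + p ^ 2 * t)) := by ring
    _ ≤ p * t ^ 2 * (1 / 20) := by gcongr
    _ = _ := by ring

lemma exists_scaledProd_re_eq {N : ℕ} (hN : 100 ≤ N) {x : Fin 3 → ℝ} (hx : x ∈ smallPhaseSet N) :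
    ∃ a b : ℝ, (scaledProd N x).re = Real.exp (-(∑ k, x k ^ 2) / 2 + a) * Real.cos b ∧
      |a - (profileMean (N ^ 2) 4 x / 24 + profileMean (N ^ 2) 2 x / 2) / N| ≤
        400 * japaneseNorm x ^ 6 / N ^ 2 ∧
      |b + profileMean (N ^ 2) 3 x / (6 * √N)| ≤ 300 * japaneseNorm x ^ 6 / (N * √N) ∧
      |a| ≤ (∑ k, x k ^ 2) / 8 + 1 := by
  have hn : (100 : ℝ) ≤ N := by exact_mod_cast hN
  have hM : 0 < N ^ 2 := by positivity
  have hp0 : (0 : ℝ) ≤ 1 / N := by positivity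
  have hp1 : 1 / (N : ℝ) ≤ 1 / 100 := one_div_le_one_div_of_le (by norm_num) hn
  obtain ⟨L, hL, hre, him⟩ := exists_prod_bernoulliChar_eq_exp hp0 (hp1.trans (by norm_num)) hx
  have hs : √(N : ℝ) ^ 2 = N := Real.sq_sqrt (by positivity)
  have hs1 : 1 ≤ √(N : ℝ) := by rw [Real.one_le_sqrt]; linarith
  set f : ℕ → ℝ := fun i => legendreProfile x (i / (N ^ 2 : ℕ)) with hf
  set s := √(N : ℝ) with hs'
  set ρ := japaneseNorm x with hρ
  have hρ1 : 1 ≤ ρ := one_le_japaneseNorm x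
  have hR : ∑ k, x k ^ 2 = ρ ^ 2 - 1 := by rw [hρ, japaneseNorm_sq]; ring
  have hS (k : ℕ) : ∑ i ∈ Finset.range (N ^ 2), f i ^ k = N ^ 2 * profileMean (N ^ 2) k x := by
    rw [profileMean]; push_cast; field_simp; simp [hf]
  have hT (k : ℕ) : ∑ i ∈ Finset.range (N ^ 2), |f i| ^ k ≤ N ^ 2 * (3 * ρ) ^ k := by
    have := sum_abs_legendreProfile_pow_le x (N ^ 2) k
    push_cast at this
    simpa [hf] using this
  have hρ6 : 0 ≤ ρ ^ 6 := by positivity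
  have hpow {k : ℕ} (hk : k ≤ 6) : ρ ^ k ≤ ρ ^ 6 := pow_le_pow_right₀ hρ1 hk
  obtain ⟨q2, hq2⟩ : ∃ q, profileMean (N ^ 2) 2 x = q := ⟨_, rfl⟩
  obtain ⟨q3, hq3⟩ : ∃ q, profileMean (N ^ 2) 3 x = q := ⟨_, rfl⟩
  obtain ⟨q4, hq4⟩ : ∃ q, profileMean (N ^ 2) 4 x = q := ⟨_, rfl⟩
  rw [hq2, hq3, hq4]
  have hs4 : s ^ 4 = (N : ℝ) ^ 2 := by rw [← hs]; ring
  have hs6 : s ^ 6 = (N : ℝ) ^ 3 := by rw [← hs]; ring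
  have hs0 : 0 < s := by linarith
  set n : ℝ := (N : ℝ) with hn'
  have hn0 : 0 < n := by linarith
  have e2 : ∑ i ∈ Finset.range (N ^ 2), 1 / n * (f i / s) ^ 2 / 2 = q2 / 2 := by
    have h (i : ℕ) : 1 / n * (f i / s) ^ 2 / 2 = 1 / (2 * n ^ 2) * f i ^ 2 := by
      rw [div_pow, hs]; field_simp
    simp_rw [h]
    rw [← Finset.mul_sum, hS, hq2]; field_simp
  have e4 : ∑ i ∈ Finset.range (N ^ 2),
        (1 / n * (f i / s) ^ 4 / 24 + (1 / n) ^ 2 * (f i / s) ^ 2 / 2)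
      = (q4 / 24 + q2 / 2) / n := by
    have h (i : ℕ) : 1 / n * (f i / s) ^ 4 / 24 + (1 / n) ^ 2 * (f i / s) ^ 2 / 2 =
        1 / (24 * n ^ 3) * f i ^ 4 + 1 / (2 * n ^ 3) * f i ^ 2 := by
      rw [div_pow (f i), div_pow (f i), hs, hs4]; field_simp
    simp_rw [h]
    rw [Finset.sum_add_distrib, ← Finset.mul_sum, ← Finset.mul_sum, hS, hS, hq2, hq4]; field_simp
  have e3 : ∑ i ∈ Finset.range (N ^ 2), 1 / n * (f i / s) ^ 3 / 6 = q3 / (6 * s) := by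
    have h (i : ℕ) : 1 / n * (f i / s) ^ 3 / 6 = 1 / (6 * n ^ 2 * s) * f i ^ 3 := by
      rw [div_pow, show s ^ 3 = n * s by rw [← hs]; ring]; field_simp
    simp_rw [h]
    rw [← Finset.mul_sum, hS, hq3]; field_simp
  have hb : ∑ i ∈ Finset.range (N ^ 2), (1 / n * |f i / s| ^ 5 + (1 / n) ^ 2 * |f i / s| ^ 3) ≤
      300 * ρ ^ 6 / (n * s) := by
    have h (i : ℕ) : 1 / n * |f i / s| ^ 5 + (1 / n) ^ 2 * |f i / s| ^ 3 =
        1 / (n ^ 3 * s) * |f i| ^ 5 + 1 / (n ^ 3 * s) * |f i| ^ 3 := by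
      rw [abs_div, abs_of_pos hs0, div_pow |f i|, div_pow |f i|,
        show s ^ 3 = n * s by rw [← hs]; ring,
        show s ^ 5 = n ^ 2 * s by rw [← hs]; ring]
      field_simp
    simp_rw [h]
    rw [Finset.sum_add_distrib, ← Finset.mul_sum, ← Finset.mul_sum]
    calc _ ≤ 1 / (n ^ 3 * s) * (n ^ 2 * (3 * ρ) ^ 5) + 1 / (n ^ 3 * s) * (n ^ 2 * (3 * ρ) ^ 3) := by
          gcongr <;> exact hT _
      _ = (243 * ρ ^ 5 + 27 * ρ ^ 3) / (n * s) := by field_simp; ring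
      _ ≤ _ := by
          gcongr
          linarith [hρ6, hpow (show 5 ≤ 6 by norm_num), hpow (show 3 ≤ 6 by norm_num)]
  have ha : ∑ i ∈ Finset.range (N ^ 2),
      (1 / n * (f i / s) ^ 6 / 4 + (1 / n) ^ 2 * (f i / s) ^ 4 + (1 / n) ^ 3 * |f i / s| ^ 3) ≤
      300 * ρ ^ 6 / n ^ 2 := by
    have h (i : ℕ) :
        1 / n * (f i / s) ^ 6 / 4 + (1 / n) ^ 2 * (f i / s) ^ 4 + (1 / n) ^ 3 * |f i / s| ^ 3 ≤
        1 / (4 * n ^ 4) * |f i| ^ 6 + 1 / n ^ 4 * |f i| ^ 4 + 1 / n ^ 4 * |f i| ^ 3 := by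
      rw [abs_div, abs_of_pos hs0, div_pow (f i), div_pow (f i), div_pow |f i|, hs4, hs6,
        show s ^ 3 = n * s by rw [← hs]; ring, Even.pow_abs (by decide : Even 6),
        Even.pow_abs (by decide : Even 4)]
      have : (1 / n) ^ 3 * (|f i| ^ 3 / (n * s)) ≤ 1 / n ^ 4 * |f i| ^ 3 := by
        calc (1 / n) ^ 3 * (|f i| ^ 3 / (n * s)) = 1 / (n ^ 4 * s) * |f i| ^ 3 := by field_simp
          _ ≤ 1 / n ^ 4 * |f i| ^ 3 := by
              gcongr
              exact le_mul_of_one_le_right (by positivity) hs1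
      have e : 1 / n * (f i ^ 6 / n ^ 3) / 4 + (1 / n) ^ 2 * (f i ^ 4 / n ^ 2) =
        1 / (4 * n ^ 4) * f i ^ 6 + 1 / n ^ 4 * f i ^ 4 := by field_simp
      linarith
    refine (Finset.sum_le_sum fun i _ => h i).trans ?_
    rw [Finset.sum_add_distrib, Finset.sum_add_distrib, ← Finset.mul_sum, ← Finset.mul_sum,
      ← Finset.mul_sum]
    calc _ ≤ 1 / (4 * n ^ 4) * (n ^ 2 * (3 * ρ) ^ 6) + 1 / n ^ 4 * (n ^ 2 * (3 * ρ) ^ 4) +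
          1 / n ^ 4 * (n ^ 2 * (3 * ρ) ^ 3) := by
          gcongr <;> exact hT _
      _ = (729 / 4 * ρ ^ 6 + 81 * ρ ^ 4 + 27 * ρ ^ 3) / n ^ 2 := by field_simp; ring
      _ ≤ _ := by
          gcongr
          linarith [hρ6, hpow (show 4 ≤ 6 by norm_num), hpow (show 3 ≤ 6 by norm_num)]
  have hq : |q2 - (ρ ^ 2 - 1)| ≤ 84 * ρ ^ 2 / n ^ 2 := by
    have := abs_profileMean_sub_integral_le x 2 hM
    rw [integral_legendreProfile_sq, hR, hq2] at this
    refine this.trans_eq ?_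
    push_cast
    ring
  rw [e2] at hL
  rw [e4] at hre
  rw [e3] at him
  refine ⟨(ρ ^ 2 - 1 - q2) / 2 + L.re, L.im, ?_, ?_, him.trans hb, ?_⟩
  · change (∏ i ∈ Finset.range (N ^ 2), bernoulliChar (1 / n) (f i / s)).re = _
    rw [hL, Complex.exp_re, hR]
    simp only [Complex.add_re, Complex.add_im, Complex.neg_re, Complex.neg_im, Complex.ofReal_re,
      Complex.ofReal_im, neg_zero, zero_add]
    congr 2
    ring
  · have h1 : |(ρ ^ 2 - 1 - q2) / 2| ≤ 42 * ρ ^ 2 / n ^ 2 := by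
      rw [abs_div, abs_sub_comm, abs_two]
      calc _ ≤ (84 * ρ ^ 2 / n ^ 2) / 2 := by gcongr
        _ = _ := by ring
    rw [add_sub_assoc]
    refine (abs_add_le _ _).trans ((add_le_add h1 (hre.trans ha)).trans ?_)
    rw [← add_div]
    gcongr
    linarith [hpow (show 2 ≤ 6 by norm_num), pow_nonneg (zero_le_one.trans hρ1) 6]
  · have hpt (i : ℕ) (hi : i ∈ Finset.range (N ^ 2)) :
        1 / n * (f i / s) ^ 4 / 24 + (1 / n) ^ 2 * (f i / s) ^ 2 / 2 +
        (1 / n * (f i / s) ^ 6 / 4 + (1 / n) ^ 2 * (f i / s) ^ 4 + (1 / n) ^ 3 * |f i / s| ^ 3) ≤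
        1 / 10 * (1 / n * (f i / s) ^ 2 / 2) :=
      small_phase_error_le hp0 hp1 (hx i hi)
    have hsum := Finset.sum_le_sum hpt
    rw [Finset.sum_add_distrib, e4, ← Finset.mul_sum, e2] at hsum
    have hLre : |L.re| ≤ 1 / 10 * (q2 / 2) := by
      have h0 : 0 ≤ (q4 / 24 + q2 / 2) / n := by
        rw [← e4]
        exact Finset.sum_nonneg fun i _ => by positivity
      have := abs_add_le (L.re - (q4 / 24 + q2 / 2) / n) ((q4 / 24 + q2 / 2) / n)
      rw [sub_add_cancel, abs_of_nonneg h0] at this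
      linarith
    have hq' : |q2 - (ρ ^ 2 - 1)| ≤ 1 / 100 * ρ ^ 2 := by
      refine hq.trans ?_
      rw [div_le_iff₀ (by positivity)]
      have h1 : (100 : ℝ) ^ 2 ≤ n ^ 2 := by gcongr
      calc 84 * ρ ^ 2 ≤ 1 / 100 * ρ ^ 2 * 100 ^ 2 := by
            linarith [pow_nonneg (zero_le_one.trans hρ1) 2]
        _ ≤ _ := by gcongr
    rw [hR]
    have := abs_add_le ((ρ ^ 2 - 1 - q2) / 2) L.re
    rw [abs_div, abs_sub_comm, abs_two] at this
    have := (abs_le.1 hq').2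
    linarith [sq_nonneg ρ]

lemma abs_exp_sub_one_le_abs_mul_exp (a : ℝ) : |Real.exp a - 1| ≤ |a| * Real.exp |a| := by
  rcases le_total 0 a with h | h
  · rw [abs_of_nonneg h, abs_of_nonneg (by linarith [Real.one_le_exp h])]
    have := mul_le_mul_of_nonneg_left (Real.add_one_le_exp (-a)) (Real.exp_pos a).le
    rw [← Real.exp_add, add_neg_cancel, Real.exp_zero] at this
    linarith
  · rw [abs_of_nonpos h, abs_of_nonpos (by linarith [Real.exp_le_one_iff.2 h])]
    have h1 := Real.one_le_exp (neg_nonneg.2 h)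
    nlinarith [Real.add_one_le_exp a]

lemma abs_exp_mul_cos_sub_one_le (a b : ℝ) :
    |Real.exp a * Real.cos b - 1| ≤ |a| * Real.exp |a| + b ^ 2 / 2 := by
  have h1 := abs_exp_sub_one_le_abs_mul_exp a
  have h2 := Real.one_sub_sq_div_two_le_cos (x := b)
  have h3 := Real.abs_cos_le_one b
  calc |Real.exp a * Real.cos b - 1| = |(Real.exp a - 1) * Real.cos b + (Real.cos b - 1)| := by
        ring_nf
    _ ≤ |Real.exp a - 1| * |Real.cos b| + |Real.cos b - 1| := by
        rw [← abs_mul]; exact abs_add_le _ _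
    _ ≤ |a| * Real.exp |a| * 1 + b ^ 2 / 2 := by
        gcongr
        rw [abs_of_nonpos (by linarith [Real.cos_le_one b])]
        linarith
    _ = _ := by ring

open Topology in
lemma tendsto_natCast_mul_exp_mul_cos_sub_one {a b : ℕ → ℝ} {α β : ℝ}
    (ha : Tendsto (fun N : ℕ => N * a N) atTop (𝓝 α))
    (hb : Tendsto (fun N : ℕ => √N * b N) atTop (𝓝 β)) :
    Tendsto (fun N : ℕ => N * (Real.exp (a N) * Real.cos (b N) - 1)) atTop
      (𝓝 (α - β ^ 2 / 2)) := by
  have hN : Tendsto (fun N : ℕ => (N : ℝ)⁻¹) atTop (𝓝 0) := tendsto_inv_atTop_nhds_zero_nat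
  have hs : Tendsto (fun N : ℕ => (√(N : ℝ))⁻¹) atTop (𝓝 0) :=
    (Real.tendsto_sqrt_atTop.comp tendsto_natCast_atTop_atTop).inv_tendsto_atTop
  have ha0 : Tendsto a atTop (𝓝 0) := by
    have := hN.mul ha
    rw [zero_mul] at this
    refine this.congr' ?_
    filter_upwards [eventually_gt_atTop 0] with N h0
    have : (0 : ℝ) < N := by exact_mod_cast h0
    field_simp
  have hb0 : Tendsto b atTop (𝓝 0) := by
    have := hs.mul hb
    rw [zero_mul] at this
    refine this.congr' ?_
    filter_upwards [eventually_gt_atTop 0] with N h0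
    have : 0 < √(N : ℝ) := by rw [Real.sqrt_pos]; exact_mod_cast h0
    field_simp
  have hd : Tendsto (fun N => dslope Real.exp 0 (a N)) atTop (𝓝 1) := by
    have := (continuousAt_dslope_same.2 (Real.differentiableAt_exp (x := 0))).tendsto.comp ha0
    simpa [dslope_same, Function.comp_def] using this
  have hsinc : Tendsto (fun N => Real.sinc (b N / 2)) atTop (𝓝 1) := by
    have := (Real.continuous_sinc.tendsto 0).comp (show Tendsto (fun N => b N / 2) atTop (𝓝 0) by
      simpa using hb0.div_const 2)
    simpa [Function.comp_def] using this
  have hcos : Tendsto (fun N => Real.cos (b N)) atTop (𝓝 1) := by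
    have := (Real.continuous_cos.tendsto 0).comp hb0
    simpa [Function.comp_def] using this
  have := ((ha.mul hd).mul hcos).sub (((hb.pow 2).div_const 2).mul (hsinc.pow 2))
  simp only [mul_one, one_pow] at this
  refine this.congr fun N => ?_
  have h1 : a N * dslope Real.exp 0 (a N) = Real.exp (a N) - 1 := by
    simpa using sub_smul_dslope Real.exp 0 (a N)
  have h2 : b N / 2 * Real.sinc (b N / 2) = Real.sin (b N / 2) := by
    by_cases h : b N / 2 = 0
    · rw [h]; simp
    · rw [Real.sinc_of_ne_zero h, mul_div_cancel₀ _ h]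
  have h3 : Real.cos (b N) = 1 - 2 * Real.sin (b N / 2) ^ 2 := by
    rw [Real.sin_sq_eq_half_sub, mul_div_cancel₀ _ (by norm_num : (2 : ℝ) ≠ 0)]; ring
  have h4 : √(N : ℝ) ^ 2 = N := Real.sq_sqrt (by positivity)
  calc _ = N * (a N * dslope Real.exp 0 (a N)) * Real.cos (b N) -
        √(N : ℝ) ^ 2 * (2 * (b N / 2 * Real.sinc (b N / 2)) ^ 2) := by ring
    _ = N * (Real.exp (a N) - 1) * Real.cos (b N) - N * (1 - Real.cos (b N)) := by
        rw [h1, h2, h4, h3]; ring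
    _ = _ := by ring

/-- The difference between the rescaled integrand, cut off at small phases, and its Gaussian limit,
multiplied by `N`. -/
noncomputable def scaledError (N : ℕ) (x : Fin 3 → ℝ) : ℝ :=
  N * ((smallPhaseSet N).indicator (fun x => (scaledProd N x).re) x -
    Real.exp (-(∑ k, x k ^ 2) / 2))

/-- The pointwise limit of `scaledError`, divided by the Gaussian weight. -/
noncomputable def correctionPoly (x : Fin 3 → ℝ) : ℝ :=
  (∑ k, x k ^ 2) / 2 + (∫ t in (0 : ℝ)..1, legendreProfile x t ^ 4) / 24 -
    (∫ t in (0 : ℝ)..1, legendreProfile x t ^ 3) ^ 2 / 72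

lemma natCast_le_of_notMem_smallPhaseSet {N : ℕ} {x : Fin 3 → ℝ} (hx : x ∉ smallPhaseSet N) :
    (N : ℝ) ≤ 36 * japaneseNorm x ^ 2 := by
  simp only [smallPhaseSet, Set.mem_ofPred_eq, not_forall, not_le] at hx
  obtain ⟨i, hi, h⟩ := hx
  have h1 := abs_legendreProfile_le x (natCast_div_mem_Icc hi)
  rw [abs_div, abs_of_nonneg (Real.sqrt_nonneg _)] at h
  have hs : 0 < √(N : ℝ) := by
    refine (Real.sqrt_nonneg _).lt_of_ne fun h0 => ?_
    rw [← h0, div_zero] at h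
    linarith
  rw [lt_div_iff₀ hs] at h
  have h2 : √(N : ℝ) ≤ 6 * japaneseNorm x := by linarith
  calc (N : ℝ) = √(N : ℝ) ^ 2 := (Real.sq_sqrt (by positivity)).symm
    _ ≤ (6 * japaneseNorm x) ^ 2 := by gcongr
    _ = _ := by ring

lemma japaneseNorm_pow_twelve_le (x : Fin 3 → ℝ) :
    japaneseNorm x ^ 12 ≤ 720 * 8 ^ 6 * Real.exp 1 * Real.exp ((∑ k, x k ^ 2) / 8) := by
  have h : japaneseNorm x ^ 12 = (1 + ∑ k, x k ^ 2) ^ 6 := by rw [← japaneseNorm_sq]; ring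
  have h0 : 0 ≤ ∑ k, x k ^ 2 := by positivity
  have h1 := Real.pow_div_factorial_le_exp ((1 + ∑ k, x k ^ 2) / 8) (by positivity) 6
  rw [h, mul_assoc, ← Real.exp_add]
  have h2 : Real.exp ((1 + ∑ k, x k ^ 2) / 8) ≤ Real.exp (1 + (∑ k, x k ^ 2) / 8) :=
    Real.exp_le_exp.2 (by linarith)
  have h3 : (Nat.factorial 6 : ℝ) = 720 := by norm_num [Nat.factorial]
  rw [h3, div_pow, div_div, div_le_iff₀ (by positivity)] at h1
  calc _ ≤ _ := h1
    _ ≤ Real.exp (1 + (∑ k, x k ^ 2) / 8) * (8 ^ 6 * 720) := by gcongr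
    _ = _ := by ring

lemma abs_scaledError_le {N : ℕ} (hN : 100 ≤ N) (x : Fin 3 → ℝ) :
    |scaledError N x| ≤
      150 * (720 * 8 ^ 6 * Real.exp 1) * Real.exp (-(∑ k, x k ^ 2) / 4) := by
  have hn : (100 : ℝ) ≤ N := by exact_mod_cast hN
  have hR0 : 0 ≤ ∑ k, x k ^ 2 := by positivity
  have hρ1 := one_le_japaneseNorm x
  suffices h : |scaledError N x| ≤
      150 * japaneseNorm x ^ 12 * Real.exp (-(3 * ∑ k, x k ^ 2) / 8) by
    refine h.trans ?_
    calc _ ≤ 150 * (720 * 8 ^ 6 * Real.exp 1 * Real.exp ((∑ k, x k ^ 2) / 8)) *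
          Real.exp (-(3 * ∑ k, x k ^ 2) / 8) := by
          gcongr; exact japaneseNorm_pow_twelve_le x
      _ = 150 * (720 * 8 ^ 6 * Real.exp 1) * (Real.exp ((∑ k, x k ^ 2) / 8) *
          Real.exp (-(3 * ∑ k, x k ^ 2) / 8)) := by ring
      _ = _ := by rw [← Real.exp_add]; congr 2; ring
  set R := ∑ k, x k ^ 2 with hR
  set ρ := japaneseNorm x with hρ
  have hpow {k : ℕ} (hk : k ≤ 12) : ρ ^ k ≤ ρ ^ 12 := pow_le_pow_right₀ hρ1 hk
  have h12 : 0 ≤ ρ ^ 12 := by positivity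
  by_cases hx : x ∈ smallPhaseSet N
  · obtain ⟨a, b, hab, ha, hb, ha'⟩ := exists_scaledProd_re_eq hN hx
    rw [scaledError, Set.indicator_of_mem hx, hab, ← hR, Real.exp_add]
    have hM : 0 < N ^ 2 := by positivity
    have q2 := abs_profileMean_le x 2 hM
    have q3 := abs_profileMean_le x 3 hM
    have q4 := abs_profileMean_le x 4 hM
    rw [← hρ] at ha hb q2 q3 q4
    set s := √(N : ℝ) with hs
    have hs2 : s ^ 2 = N := Real.sq_sqrt (by positivity)
    have hs0 : 0 < s := by rw [hs, Real.sqrt_pos]; linarith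
    set n : ℝ := (N : ℝ) with hn'
    have hn0 : 0 < n := by linarith
    have ha2 : n * |a| ≤ 14 * ρ ^ 12 := by
      have e := abs_add_le (a - (profileMean (N ^ 2) 4 x / 24 + profileMean (N ^ 2) 2 x / 2) / n)
        ((profileMean (N ^ 2) 4 x / 24 + profileMean (N ^ 2) 2 x / 2) / n)
      rw [sub_add_cancel] at e
      have e1 : |(profileMean (N ^ 2) 4 x / 24 + profileMean (N ^ 2) 2 x / 2) / n| ≤
          (81 / 24 * ρ ^ 4 + 9 / 2 * ρ ^ 2) / n := by
        rw [abs_div, abs_of_pos hn0]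
        gcongr
        refine (abs_add_le _ _).trans ?_
        rw [abs_div, abs_div, abs_two, abs_of_pos (by norm_num : (0 : ℝ) < 24)]
        linarith
      calc n * |a| ≤ n * (400 * ρ ^ 6 / n ^ 2 + (81 / 24 * ρ ^ 4 + 9 / 2 * ρ ^ 2) / n) := by
            gcongr; linarith
        _ = 400 * ρ ^ 6 / n + (81 / 24 * ρ ^ 4 + 9 / 2 * ρ ^ 2) := by field_simp
        _ ≤ 400 * ρ ^ 6 / 100 + (81 / 24 * ρ ^ 4 + 9 / 2 * ρ ^ 2) := by gcongr
        _ ≤ _ := by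
            linarith [hpow (show 6 ≤ 12 by norm_num), hpow (show 4 ≤ 12 by norm_num),
              hpow (show 2 ≤ 12 by norm_num)]
    have hb2 : n * b ^ 2 ≤ 64 * ρ ^ 12 := by
      have e := abs_sub (b + profileMean (N ^ 2) 3 x / (6 * s)) (profileMean (N ^ 2) 3 x / (6 * s))
      rw [add_sub_cancel_right] at e
      have e1 : |profileMean (N ^ 2) 3 x / (6 * s)| ≤ 27 * ρ ^ 3 / (6 * s) := by
        rw [abs_div, abs_of_pos (by positivity : 0 < 6 * s)]
        gcongr
        linarith
      have e2 : s * |b| ≤ 8 * ρ ^ 6 := by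
        calc s * |b| ≤ s * (300 * ρ ^ 6 / (n * s) + 27 * ρ ^ 3 / (6 * s)) := by gcongr; linarith
          _ = 300 * ρ ^ 6 / n + 27 / 6 * ρ ^ 3 := by field_simp
          _ ≤ 300 * ρ ^ 6 / 100 + 27 / 6 * ρ ^ 3 := by gcongr
          _ ≤ _ := by
            linarith [pow_le_pow_right₀ hρ1 (show 3 ≤ 6 by norm_num),
              pow_nonneg (zero_le_one.trans hρ1) 6]
      calc n * b ^ 2 = (s * |b|) ^ 2 := by rw [mul_pow, sq_abs, hs2]
        _ ≤ (8 * ρ ^ 6) ^ 2 := by gcongr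
        _ = _ := by ring
    have hmain := abs_exp_mul_cos_sub_one_le a b
    have he : Real.exp 1 ≤ 3 := by linarith [Real.exp_one_lt_d9]
    have hR8 : 1 ≤ Real.exp (R / 8) := Real.one_le_exp (by positivity)
    calc |n * (Real.exp (-R / 2) * Real.exp a * Real.cos b - Real.exp (-R / 2))|
        = Real.exp (-R / 2) * (n * |Real.exp a * Real.cos b - 1|) := by
          rw [show n * (Real.exp (-R / 2) * Real.exp a * Real.cos b - Real.exp (-R / 2)) =
            Real.exp (-R / 2) * (n * (Real.exp a * Real.cos b - 1)) by ring, abs_mul, abs_mul,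
            Real.abs_exp, abs_of_pos hn0]
      _ ≤ Real.exp (-R / 2) * (n * (|a| * Real.exp |a| + b ^ 2 / 2)) := by gcongr
      _ = Real.exp (-R / 2) * (n * |a| * Real.exp |a| + n * b ^ 2 / 2) := by ring
      _ ≤ Real.exp (-R / 2) * (14 * ρ ^ 12 * Real.exp (R / 8 + 1) + 64 * ρ ^ 12 / 2) := by gcongr
      _ = Real.exp (-R / 2) * (14 * ρ ^ 12 * (Real.exp (R / 8) * Real.exp 1) +
            32 * ρ ^ 12 * 1) := by rw [Real.exp_add]; ring
      _ ≤ Real.exp (-R / 2) * (14 * ρ ^ 12 * (Real.exp (R / 8) * 3) +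
            32 * ρ ^ 12 * Real.exp (R / 8)) := by gcongr
      _ = 74 * ρ ^ 12 * (Real.exp (-R / 2) * Real.exp (R / 8)) := by ring
      _ = 74 * ρ ^ 12 * Real.exp (-(3 * R) / 8) := by
          rw [← Real.exp_add]; congr 2; ring
      _ ≤ _ := by gcongr; norm_num
  · rw [scaledError, Set.indicator_of_notMem hx, zero_sub, mul_neg, abs_neg,
      abs_of_nonneg (by positivity)]
    have h1 := natCast_le_of_notMem_smallPhaseSet hx
    rw [← hρ] at h1
    have h2 : Real.exp (-R / 2) ≤ Real.exp (-(3 * R) / 8) := Real.exp_le_exp.2 (by linarith)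
    gcongr
    linarith [hpow (show 2 ≤ 12 by norm_num)]

open Topology in
lemma tendsto_scaledError (x : Fin 3 → ℝ) :
    Tendsto (fun N => scaledError N x) atTop
      (𝓝 (correctionPoly x * Real.exp (-(∑ k, x k ^ 2) / 2))) := by
  have hev : ∀ᶠ N : ℕ in atTop, 100 ≤ N ∧ x ∈ smallPhaseSet N := by
    filter_upwards [eventually_ge_atTop 100,
      tendsto_natCast_atTop_atTop.eventually_gt_atTop (36 * japaneseNorm x ^ 2)] with N h1 h2
    refine ⟨h1, ?_⟩
    by_contra h
    exact absurd (natCast_le_of_notMem_smallPhaseSet h) (not_le.2 h2)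
  have hex (N : ℕ) (h : 100 ≤ N ∧ x ∈ smallPhaseSet N) := exists_scaledProd_re_eq h.1 h.2
  choose! a b hab ha hb ha' using hex
  have hN : Tendsto (fun N : ℕ => (N : ℝ)⁻¹) atTop (𝓝 0) := tendsto_inv_atTop_nhds_zero_nat
  have hlima : Tendsto (fun N : ℕ => N * a N) atTop
      (𝓝 ((∫ t in (0 : ℝ)..1, legendreProfile x t ^ 4) / 24 +
        (∫ t in (0 : ℝ)..1, legendreProfile x t ^ 2) / 2)) := by
    have h1 := ((tendsto_profileMean x 4).div_const 24).add ((tendsto_profileMean x 2).div_const 2)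
    have h2 : Tendsto (fun N : ℕ => N * a N -
        (profileMean (N ^ 2) 4 x / 24 + profileMean (N ^ 2) 2 x / 2)) atTop (𝓝 0) := by
      refine squeeze_zero_norm' (a := fun N : ℕ => 400 * japaneseNorm x ^ 6 * (N : ℝ)⁻¹) ?_
        (by simpa using hN.const_mul (400 * japaneseNorm x ^ 6))
      filter_upwards [hev] with N h
      have hn : (0 : ℝ) < N := by exact_mod_cast (by omega : 0 < N)
      rw [Real.norm_eq_abs]
      calc _ = |N * (a N - (profileMean (N ^ 2) 4 x / 24 + profileMean (N ^ 2) 2 x / 2) / N)| := by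
            congr 1; field_simp
        _ ≤ N * (400 * japaneseNorm x ^ 6 / N ^ 2) := by
            rw [abs_mul, abs_of_pos hn]; gcongr; exact ha N h
        _ = _ := by field_simp
    simpa using h2.add h1
  have hlimb : Tendsto (fun N : ℕ => √N * b N) atTop
      (𝓝 (-((∫ t in (0 : ℝ)..1, legendreProfile x t ^ 3) / 6))) := by
    have h1 := ((tendsto_profileMean x 3).div_const 6).neg
    have h2 : Tendsto (fun N : ℕ => √N * b N + profileMean (N ^ 2) 3 x / 6) atTop (𝓝 0) := by
      refine squeeze_zero_norm' (a := fun N : ℕ => 300 * japaneseNorm x ^ 6 * (N : ℝ)⁻¹) ?_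
        (by simpa using hN.const_mul (300 * japaneseNorm x ^ 6))
      filter_upwards [hev] with N h
      have hn : (0 : ℝ) < N := by exact_mod_cast (by omega : 0 < N)
      have hs : 0 < √(N : ℝ) := Real.sqrt_pos.2 hn
      rw [Real.norm_eq_abs]
      calc _ = |√N * (b N + profileMean (N ^ 2) 3 x / (6 * √N))| := by
            congr 1; field_simp
        _ ≤ √N * (300 * japaneseNorm x ^ 6 / (N * √N)) := by
            rw [abs_mul, abs_of_pos hs]; gcongr; exact hb N h
        _ = _ := by field_simp
    simpa using h2.add h1
  have := (tendsto_natCast_mul_exp_mul_cos_sub_one hlima hlimb).mul_const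
    (Real.exp (-(∑ k, x k ^ 2) / 2))
  rw [show correctionPoly x = (∫ t in (0 : ℝ)..1, legendreProfile x t ^ 4) / 24 +
    (∫ t in (0 : ℝ)..1, legendreProfile x t ^ 2) / 2 -
    (-((∫ t in (0 : ℝ)..1, legendreProfile x t ^ 3) / 6)) ^ 2 / 2 by
      rw [correctionPoly, integral_legendreProfile_sq]; ring]
  refine this.congr' ?_
  filter_upwards [hev] with N h
  rw [scaledError, Set.indicator_of_mem h.2, hab N h, Real.exp_add]
  ring

lemma measurableSet_smallPhaseSet (N : ℕ) : MeasurableSet (smallPhaseSet N) := by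
  have : smallPhaseSet N = ⋂ i ∈ Finset.range (N ^ 2),
      {x | |legendreProfile x (i / (N ^ 2 : ℕ)) / √N| ≤ 1 / 2} := by
    ext x; simp [smallPhaseSet]
  rw [this]
  refine Finset.measurableSet_biInter _ fun i _ => (isClosed_le ?_ continuous_const).measurableSet
  unfold legendreProfile
  fun_prop

lemma continuous_scaledProd (N : ℕ) : Continuous (scaledProd N) := by
  unfold scaledProd bernoulliChar legendreProfile
  fun_prop

lemma integrable_exp_neg_sum_sq {c : ℝ} (hc : 0 < c) :
    MeasureTheory.Integrable fun x : Fin 3 → ℝ => Real.exp (-(∑ k, x k ^ 2) / c) := by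
  have h := MeasureTheory.Integrable.fintype_prod
    (f := fun (_ : Fin 3) (y : ℝ) => Real.exp (-c⁻¹ * y ^ 2))
    (μ := fun _ => MeasureTheory.volume) fun _ => integrable_exp_neg_mul_sq (inv_pos.2 hc)
  refine h.congr (Eventually.of_forall fun x => ?_)
  simp only
  rw [← Real.exp_sum, ← Finset.mul_sum]
  congr 1
  field_simp

open Topology in
lemma tendsto_integral_scaledError :
    Tendsto (fun N => ∫ x, scaledError N x) atTop
      (𝓝 (∫ x, correctionPoly x * Real.exp (-(∑ k, x k ^ 2) / 2))) := by
  refine MeasureTheory.tendsto_integral_filter_of_dominated_convergence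
    (fun x => 150 * (720 * 8 ^ 6 * Real.exp 1) * Real.exp (-(∑ k, x k ^ 2) / 4)) ?_ ?_ ?_ ?_
  · refine Eventually.of_forall fun N => Measurable.aestronglyMeasurable ?_
    unfold scaledError
    have h := ((Complex.continuous_re.comp (continuous_scaledProd N)).measurable).indicator
      (measurableSet_smallPhaseSet N)
    exact (h.sub (by fun_prop)).const_mul _
  · filter_upwards [eventually_ge_atTop 100] with N hN
    exact Eventually.of_forall fun x => abs_scaledError_le hN x
  · exact (integrable_exp_neg_sum_sq (by norm_num)).const_mul _
  · exact Eventually.of_forall tendsto_scaledError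

/-- The moments of the standard Gaussian distribution. -/
def gaussMoment : ℕ → ℝ
  | 0 => 1
  | 1 => 0
  | k + 2 => (k + 1) * gaussMoment k

lemma integrable_pow_mul_exp_neg_sq_div_two (k : ℕ) :
    MeasureTheory.Integrable fun y : ℝ => y ^ k * Real.exp (-y ^ 2 / 2) := by
  have h := integrable_rpow_mul_exp_neg_mul_sq (b := 1 / 2) (by norm_num) (s := k)
    (by linarith [(Nat.cast_nonneg k : (0 : ℝ) ≤ k)])
  refine h.congr (Eventually.of_forall fun y => ?_)
  simp only [Real.rpow_natCast]
  ring_nf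

lemma hasDerivAt_neg_exp_neg_sq_div_two (y : ℝ) :
    HasDerivAt (fun y : ℝ => -Real.exp (-y ^ 2 / 2)) (y * Real.exp (-y ^ 2 / 2)) y := by
  refine ((((hasDerivAt_pow 2 y).neg).div_const 2).exp.neg).congr_deriv ?_
  norm_num
  ring

lemma integral_pow_mul_exp_neg_sq_div_two (k : ℕ) :
    ∫ y : ℝ, y ^ k * Real.exp (-y ^ 2 / 2) = gaussMoment k * √(2 * Real.pi) := by
  induction k using gaussMoment.induct with
  | case1 =>
    have h := integral_gaussian (1 / 2)
    rw [show Real.pi / (1 / 2) = 2 * Real.pi by ring] at h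
    rw [gaussMoment, one_mul, ← h]
    congr 1
    ext y
    ring_nf
  | case2 =>
    rw [gaussMoment, zero_mul]
    have h0 := (integrable_pow_mul_exp_neg_sq_div_two 0).neg
    refine MeasureTheory.integral_eq_zero_of_hasDerivAt_of_integrable
      (f := fun y => -Real.exp (-y ^ 2 / 2)) (fun y => ?_)
      (integrable_pow_mul_exp_neg_sq_div_two 1) (h0.congr (Eventually.of_forall fun y => ?_))
    · simpa using hasDerivAt_neg_exp_neg_sq_div_two y
    · simp
  | case3 k ih =>
    have h := MeasureTheory.integral_mul_deriv_eq_deriv_mul_of_integrable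
      (u := fun y : ℝ => y ^ (k + 1)) (v := fun y => -Real.exp (-y ^ 2 / 2))
      (u' := fun y => (k + 1) * y ^ k) (v' := fun y => y * Real.exp (-y ^ 2 / 2))
      (fun y _ => by simpa using hasDerivAt_pow (k + 1) y)
      (fun y _ => hasDerivAt_neg_exp_neg_sq_div_two y)
      ((integrable_pow_mul_exp_neg_sq_div_two (k + 2)).congr (Eventually.of_forall fun y => by
        simp only [Pi.mul_apply]; ring))
      (((integrable_pow_mul_exp_neg_sq_div_two k).const_mul (-(k + 1))).congr
        (Eventually.of_forall fun y => by simp only [Pi.mul_apply]; ring))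
      ((integrable_pow_mul_exp_neg_sq_div_two (k + 1)).neg.congr (Eventually.of_forall fun y => by
        simp only [Pi.mul_apply, Pi.neg_apply]; ring))
    rw [gaussMoment, mul_assoc, ← ih, ← MeasureTheory.integral_const_mul]
    calc _ = ∫ y : ℝ, y ^ (k + 1) * (y * Real.exp (-y ^ 2 / 2)) := by
          congr 1; ext y; rw [Nat.succ_eq_add_one]; ring
      _ = _ := by
        rw [h, ← MeasureTheory.integral_neg]; congr 1; ext y; ring

/-- `f` has mean `m` with respect to the standard Gaussian measure on `ℝ³`. -/
def HasGaussianMean (f : (Fin 3 → ℝ) → ℝ) (m : ℝ) : Prop :=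
  MeasureTheory.Integrable (fun x => f x * Real.exp (-(∑ k, x k ^ 2) / 2)) ∧
    ∫ x, f x * Real.exp (-(∑ k, x k ^ 2) / 2) = m * √(2 * Real.pi) ^ 3

lemma HasGaussianMean.add {f g : (Fin 3 → ℝ) → ℝ} {m n : ℝ} (hf : HasGaussianMean f m)
    (hg : HasGaussianMean g n) : HasGaussianMean (fun x => f x + g x) (m + n) := by
  refine ⟨(hf.1.add hg.1).congr (Eventually.of_forall fun x => ?_), ?_⟩
  · simp only [Pi.add_apply]; ring
  · simp_rw [add_mul]
    rw [MeasureTheory.integral_add hf.1 hg.1, hf.2, hg.2]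

lemma HasGaussianMean.const_mul {f : (Fin 3 → ℝ) → ℝ} {m : ℝ} (hf : HasGaussianMean f m)
    (c : ℝ) : HasGaussianMean (fun x => c * f x) (c * m) := by
  refine ⟨(hf.1.const_mul c).congr (Eventually.of_forall fun x => ?_), ?_⟩
  · simp only; ring
  · simp_rw [mul_assoc]
    rw [MeasureTheory.integral_const_mul, hf.2]

lemma hasGaussianMean_monomial (a b c : ℕ) :
    HasGaussianMean (fun x => x 0 ^ a * x 1 ^ b * x 2 ^ c)
      (gaussMoment a * gaussMoment b * gaussMoment c) := by
  have e (x : Fin 3 → ℝ) : x 0 ^ a * x 1 ^ b * x 2 ^ c * Real.exp (-(∑ k, x k ^ 2) / 2) =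
      ∏ i, x i ^ (![a, b, c] i) * Real.exp (-x i ^ 2 / 2) := by
    rw [Finset.prod_mul_distrib, ← Real.exp_sum, ← Finset.sum_div, Finset.sum_neg_distrib]
    simp [Fin.prod_univ_three]
  unfold HasGaussianMean
  simp_rw [e]
  refine ⟨MeasureTheory.Integrable.fintype_prod
    (f := fun (i : Fin 3) (y : ℝ) => y ^ (![a, b, c] i) * Real.exp (-y ^ 2 / 2))
    fun i => integrable_pow_mul_exp_neg_sq_div_two _, ?_⟩
  rw [MeasureTheory.integral_fintype_prod_volume_eq_prod
    (fun (i : Fin 3) (y : ℝ) => y ^ (![a, b, c] i) * Real.exp (-y ^ 2 / 2))]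
  simp_rw [integral_pow_mul_exp_neg_sq_div_two]
  simp [Fin.prod_univ_three]
  ring

lemma correctionPoly_eq (x : Fin 3 → ℝ) : correctionPoly x =
    (x 0 ^ 2 + x 1 ^ 2 + x 2 ^ 2) / 2 +
      (x 0 ^ 4 + 6 * x 0 ^ 2 * x 1 ^ 2 + 6 * x 0 ^ 2 * x 2 ^ 2 +
        24 / 5 * √5 * x 0 * x 1 ^ 2 * x 2 + 8 / 7 * √5 * x 0 * x 2 ^ 3 + 9 / 5 * x 1 ^ 4 +
        66 / 7 * x 1 ^ 2 * x 2 ^ 2 + 15 / 7 * x 2 ^ 4) / 24 -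
      (x 0 ^ 3 + 3 * x 0 * x 1 ^ 2 + 3 * x 0 * x 2 ^ 2 + 6 / 5 * √5 * x 1 ^ 2 * x 2 +
        2 / 7 * √5 * x 2 ^ 3) ^ 2 / 72 := by
  have h3 : √(3 : ℝ) ^ 2 = 3 := Real.sq_sqrt (by norm_num)
  have h5 : √(5 : ℝ) ^ 2 = 5 := Real.sq_sqrt (by norm_num)
  have h34 : √(3 : ℝ) ^ 4 = 9 := by rw [show √(3 : ℝ) ^ 4 = (√3 ^ 2) ^ 2 by ring, h3]; norm_num
  have h54 : √(5 : ℝ) ^ 4 = 25 := by rw [show √(5 : ℝ) ^ 4 = (√5 ^ 2) ^ 2 by ring, h5]; norm_num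
  have h53 : √(5 : ℝ) ^ 3 = 5 * √5 := by rw [pow_succ, h5]
  rw [correctionPoly, integral_legendreProfile_cube, integral_legendreProfile_pow_four,
    Fin.sum_univ_three]
  simp only [mul_pow, h3, h5, h34, h54, h53]
  ring

lemma hasGaussianMean_correctionPoly : HasGaussianMean correctionPoly (1787 / 2940 + 1 / 6) := by
  have h5 : √(5 : ℝ) ^ 2 = 5 := Real.sq_sqrt (by norm_num)
  have h := ((hasGaussianMean_monomial 2 0 0).const_mul (1 / 2)) |>.add
    ((hasGaussianMean_monomial 0 2 0).const_mul (1 / 2)) |>.add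
    ((hasGaussianMean_monomial 0 0 2).const_mul (1 / 2)) |>.add
    ((hasGaussianMean_monomial 4 0 0).const_mul (1 / 24)) |>.add
    ((hasGaussianMean_monomial 2 2 0).const_mul (1 / 4)) |>.add
    ((hasGaussianMean_monomial 2 0 2).const_mul (1 / 4)) |>.add
    ((hasGaussianMean_monomial 1 2 1).const_mul (1 / 5 * √5)) |>.add
    ((hasGaussianMean_monomial 1 0 3).const_mul (1 / 21 * √5)) |>.add
    ((hasGaussianMean_monomial 0 4 0).const_mul (3 / 40)) |>.add
    ((hasGaussianMean_monomial 0 2 2).const_mul (11 / 28)) |>.add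
    ((hasGaussianMean_monomial 0 0 4).const_mul (5 / 56)) |>.add
    ((hasGaussianMean_monomial 6 0 0).const_mul (-(1 / 72))) |>.add
    ((hasGaussianMean_monomial 4 2 0).const_mul (-(1 / 12))) |>.add
    ((hasGaussianMean_monomial 4 0 2).const_mul (-(1 / 12))) |>.add
    ((hasGaussianMean_monomial 3 2 1).const_mul (-(1 / 30) * √5)) |>.add
    ((hasGaussianMean_monomial 3 0 3).const_mul (-(1 / 126) * √5)) |>.add
    ((hasGaussianMean_monomial 2 4 0).const_mul (-(1 / 8))) |>.add
    ((hasGaussianMean_monomial 2 2 2).const_mul (-(1 / 4))) |>.add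
    ((hasGaussianMean_monomial 1 4 1).const_mul (-(1 / 10) * √5)) |>.add
    ((hasGaussianMean_monomial 1 2 3).const_mul (-(13 / 105) * √5)) |>.add
    ((hasGaussianMean_monomial 2 0 4).const_mul (-(1 / 8))) |>.add
    ((hasGaussianMean_monomial 1 0 5).const_mul (-(1 / 42) * √5)) |>.add
    ((hasGaussianMean_monomial 0 4 2).const_mul (-(1 / 10))) |>.add
    ((hasGaussianMean_monomial 0 2 4).const_mul (-(1 / 21))) |>.add
    ((hasGaussianMean_monomial 0 0 6).const_mul (-(5 / 882)))
  convert h using 1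
  · ext x
    rw [correctionPoly_eq]
    linear_combination (-(6 / 5 * x 1 ^ 2 * x 2 + 2 / 7 * x 2 ^ 3) ^ 2 / 72) * h5
  · simp only [gaussMoment]
    norm_num

open Topology MeasureTheory in
lemma tendsto_setIntegral_scaledProd_re :
    Tendsto (fun N : ℕ => N * ((∫ x in smallPhaseSet N, (scaledProd N x).re) /
      √(2 * Real.pi) ^ 3 - 1)) atTop (𝓝 (1787 / 2940 + 1 / 6)) := by
  have hπ : 0 < √(2 * Real.pi) ^ 3 := by positivity
  have hgauss : ∫ x : Fin 3 → ℝ, Real.exp (-(∑ k, x k ^ 2) / 2) = √(2 * Real.pi) ^ 3 := by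
    simpa [gaussMoment] using (hasGaussianMean_monomial 0 0 0).2
  have h := tendsto_integral_scaledError.div_const (√(2 * Real.pi) ^ 3)
  rw [hasGaussianMean_correctionPoly.2, mul_div_cancel_right₀ _ hπ.ne'] at h
  refine h.congr' ?_
  filter_upwards [eventually_ge_atTop 100] with N hN
  have hn : (N : ℝ) ≠ 0 := by
    have : 0 < N := by omega
    exact_mod_cast this.ne'
  have hmeas : Measurable ((smallPhaseSet N).indicator fun x => (scaledProd N x).re) :=
    ((Complex.continuous_re.comp (continuous_scaledProd N)).measurable).indicator
      (measurableSet_smallPhaseSet N)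
  have hint : Integrable (scaledError N) := by
    refine ((integrable_exp_neg_sum_sq (c := 4) (by norm_num)).const_mul
      (150 * (720 * 8 ^ 6 * Real.exp 1))).mono' ?_ (Eventually.of_forall (abs_scaledError_le hN))
    unfold scaledError
    exact ((hmeas.sub (by fun_prop)).const_mul _).aestronglyMeasurable
  have hind : ∫ x in smallPhaseSet N, (scaledProd N x).re =
      (∫ x, scaledError N x) / N + √(2 * Real.pi) ^ 3 := by
    rw [← integral_indicator (measurableSet_smallPhaseSet N), ← hgauss, ← integral_div,
      ← integral_add (hint.div_const _) (integrable_exp_neg_sum_sq (by norm_num))]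
    congr 1
    ext x
    rw [scaledError]
    field_simp
    ring
  rw [hind]
  field_simp
  ring

/-- The linear change of variables from rescaled coordinates to phase coefficients. -/
noncomputable def phaseMatrix (N : ℕ) : Matrix (Fin 3) (Fin 3) ℝ :=
  (2 * Real.pi * √N)⁻¹ •
    !![1, -√3, √5; 0, 2 * √3 / N ^ 2, -(6 * √5) / N ^ 2 + 6 * √5 / (N ^ 2) ^ 2;
      0, 0, 12 * √5 / (N ^ 2) ^ 2]

lemma det_phaseMatrix (N : ℕ) :
    (phaseMatrix N).det = 24 * (√3 * √5) / ((2 * Real.pi * √N) ^ 3 * (N ^ 2) ^ 3) := by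
  rw [phaseMatrix, Matrix.det_smul, Matrix.det_fin_three]
  simp
  field_simp
  norm_num

lemma two_pi_mul_quadPhase_phaseMatrix {N : ℕ} (hN : 0 < N) (x : Fin 3 → ℝ) (i : ℕ) :
    2 * Real.pi * quadPhase (Matrix.toLin' (phaseMatrix N) x) i =
      legendreProfile x (i / (N ^ 2 : ℕ)) / √N := by
  have hn : (0 : ℝ) < N := by exact_mod_cast hN
  have hs : 0 < √(N : ℝ) := Real.sqrt_pos.2 hn
  have hπ := Real.pi_pos
  rw [quadPhase, legendreProfile_eq, Matrix.toLin'_apply]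
  simp [phaseMatrix, Matrix.mulVec, dotProduct, Fin.sum_univ_three]
  field_simp
  ring

/-- The coefficient vectors at which all phases are small. -/
def smallCoeffSet (N : ℕ) : Set (Fin 3 → ℝ) :=
  {v | ∀ i ∈ Finset.range (N ^ 2), |2 * Real.pi * quadPhase v i| ≤ 1 / 2}

lemma isClosed_smallCoeffSet (N : ℕ) : IsClosed (smallCoeffSet N) := by
  have : smallCoeffSet N = ⋂ i ∈ Finset.range (N ^ 2),
      {v | |2 * Real.pi * quadPhase v i| ≤ 1 / 2} := by
    ext x; simp [smallCoeffSet]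
  rw [this]
  refine isClosed_biInter fun i _ => isClosed_le ?_ continuous_const
  unfold quadPhase
  fun_prop

lemma continuous_prod_bernoulliChar_quadPhase (N : ℕ) : Continuous fun v : Fin 3 → ℝ =>
    ∏ i ∈ Finset.range (N ^ 2), bernoulliChar (1 / N) (2 * Real.pi * quadPhase v i) := by
  unfold bernoulliChar quadPhase
  fun_prop

lemma smallCoeffSet_subset_torusBox {N : ℕ} (hN : 2 ≤ N) : smallCoeffSet N ⊆ torusBox := by
  intro v hv
  have hM : 3 ≤ N ^ 2 := by nlinarith
  have h (i : ℕ) (hi : i < 3) : |quadPhase v i| ≤ 1 / 12 := by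
    have h1 := hv i (Finset.mem_range.2 (by omega))
    rw [abs_mul, abs_of_pos (by positivity)] at h1
    nlinarith [Real.pi_gt_three, abs_nonneg (quadPhase v i)]
  have h0 := abs_le.1 (h 0 (by norm_num))
  have h1 := abs_le.1 (h 1 (by norm_num))
  have h2 := abs_le.1 (h 2 (by norm_num))
  simp only [quadPhase] at h0 h1 h2
  norm_num at h0 h1 h2
  simp only [torusBox, Set.mem_pi, Set.mem_univ, true_implies, Set.mem_Icc]
  intro k
  fin_cases k <;> constructor <;> simp <;> linarith

lemma indicator_smallCoeffSet_phaseMatrix {N : ℕ} (hN : 0 < N) (x : Fin 3 → ℝ) :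
    (smallCoeffSet N).indicator (fun v => ∏ i ∈ Finset.range (N ^ 2),
        bernoulliChar (1 / N) (2 * Real.pi * quadPhase v i)) (Matrix.toLin' (phaseMatrix N) x) =
      (smallPhaseSet N).indicator (scaledProd N) x := by
  have hiff : Matrix.toLin' (phaseMatrix N) x ∈ smallCoeffSet N ↔ x ∈ smallPhaseSet N := by
    simp only [smallCoeffSet, smallPhaseSet, Set.mem_ofPred_eq,
      two_pi_mul_quadPhase_phaseMatrix hN]
  by_cases hx : x ∈ smallPhaseSet N
  · rw [Set.indicator_of_mem (hiff.2 hx), Set.indicator_of_mem hx, scaledProd]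
    simp only [two_pi_mul_quadPhase_phaseMatrix hN]
  · rw [Set.indicator_of_notMem (mt hiff.1 hx), Set.indicator_of_notMem hx]

open MeasureTheory in
lemma integrableOn_prod_bernoulliChar_quadPhase (N : ℕ) :
    IntegrableOn (fun v : Fin 3 → ℝ => ∏ i ∈ Finset.range (N ^ 2),
      bernoulliChar (1 / N) (2 * Real.pi * quadPhase v i)) torusBox :=
  (continuous_prod_bernoulliChar_quadPhase N).continuousOn.integrableOn_compact
    (isCompact_univ_pi fun _ => isCompact_Icc)

open MeasureTheory in
/-- The change of variables to rescaled coordinates. -/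
lemma integrableOn_scaledProd_and_setIntegral_smallCoeffSet {N : ℕ} (hN : 2 ≤ N) :
    IntegrableOn (scaledProd N) (smallPhaseSet N) ∧
      ∫ v in smallCoeffSet N,
          ∏ i ∈ Finset.range (N ^ 2), bernoulliChar (1 / N) (2 * Real.pi * quadPhase v i) =
        ((phaseMatrix N).det : ℂ) * ∫ x in smallPhaseSet N, scaledProd N x := by
  have hN0 : 0 < N := by omega
  have hn : (0 : ℝ) < N := by exact_mod_cast hN0
  have hdet : 0 < (phaseMatrix N).det := by rw [det_phaseMatrix]; positivity
  have hφ : AEMeasurable (Matrix.toLin' (phaseMatrix N)) volume :=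
    (LinearMap.continuous_of_finiteDimensional _).measurable.aemeasurable
  have hG := (continuous_prod_bernoulliChar_quadPhase N).measurable.indicator
    (isClosed_smallCoeffSet N).measurableSet
  have hGi := ((integrableOn_prod_bernoulliChar_quadPhase N).mono_set
    (smallCoeffSet_subset_torusBox hN)).integrable_indicator
    (isClosed_smallCoeffSet N).measurableSet
  constructor
  · rw [← integrable_indicator_iff (measurableSet_smallPhaseSet N)]
    have h := (integrable_map_measure hG.aestronglyMeasurable hφ).1 (by
      rw [Real.map_matrix_volume_pi_eq_smul_volume_pi hdet.ne']
      exact hGi.smul_measure ENNReal.ofReal_ne_top)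
    exact h.congr (Filter.Eventually.of_forall (indicator_smallCoeffSet_phaseMatrix hN0))
  · have hmap := integral_map hφ hG.aestronglyMeasurable
    rw [Real.map_matrix_volume_pi_eq_smul_volume_pi hdet.ne', integral_smul_measure] at hmap
    simp_rw [indicator_smallCoeffSet_phaseMatrix hN0] at hmap
    rw [integral_indicator (measurableSet_smallPhaseSet N),
      integral_indicator (isClosed_smallCoeffSet N).measurableSet,
      ENNReal.toReal_ofReal (abs_nonneg _), abs_of_pos (inv_pos.2 hdet)] at hmap
    rw [← hmap, Complex.real_smul, ← mul_assoc, ← Complex.ofReal_mul, mul_inv_cancel₀ hdet.ne']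
    simp

lemma norm_prod_bernoulliChar_le {N : ℕ} (hN : 3 ≤ N) {v : Fin 3 → ℝ} (hv : v ∈ torusBox)
    (hv' : v ∉ smallCoeffSet N) :
    ‖∏ i ∈ Finset.range (N ^ 2), bernoulliChar (1 / N) (2 * Real.pi * quadPhase v i)‖ ≤
      Real.exp (-((1 / 200000) ^ 2 * N)) := by
  have hn : (3 : ℝ) ≤ N := by exact_mod_cast hN
  simp only [torusBox, Set.mem_pi, Set.mem_univ, true_implies, Set.mem_Icc] at hv
  have hsum : (1 / 200000 : ℝ) ^ 2 * (N ^ 2 : ℕ) ≤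
      ∑ i ∈ Finset.range (N ^ 2), Real.sin (Real.pi * quadPhase v i) ^ 2 := by
    by_contra hlt
    apply hv'
    intro i hi
    have h1 := quadPhase_abs_le (v := v)
      (fun k => abs_le.2 ⟨by linarith [(hv k).1], (hv k).2⟩) (M := N ^ 2)
      (by nlinarith) (ε := 1 / 200000) (by norm_num) le_rfl (not_le.1 hlt).le i
      (Finset.mem_range.1 hi)
    rw [abs_mul, abs_of_pos (by positivity)]
    nlinarith [Real.pi_lt_d2, Real.pi_pos, abs_nonneg (quadPhase v i)]
  rw [norm_prod]
  calc _ ≤ ∏ i ∈ Finset.range (N ^ 2),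
        Real.exp (-(2 * (1 / N) * (1 - 1 / N) * Real.sin (Real.pi * quadPhase v i) ^ 2)) := by
        refine Finset.prod_le_prod (fun _ _ => norm_nonneg _) fun i _ => ?_
        refine (norm_bernoulliChar_le _ _).trans_eq ?_
        congr 6
        ring
    _ = Real.exp (-(2 * (1 / N) * (1 - 1 / N) *
        ∑ i ∈ Finset.range (N ^ 2), Real.sin (Real.pi * quadPhase v i) ^ 2)) := by
        rw [← Real.exp_sum, Finset.sum_neg_distrib, Finset.mul_sum]
    _ ≤ _ := by
        refine Real.exp_le_exp.2 (neg_le_neg ?_)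
        have hp : 1 / (N : ℝ) ≤ 1 / 2 := one_div_le_one_div_of_le (by norm_num) (by linarith)
        have hp0 : 0 ≤ 1 / (N : ℝ) := by positivity
        have h0 : 0 ≤ 2 * (1 / (N : ℝ)) * (1 - 1 / N) := mul_nonneg (by positivity) (by linarith)
        calc (1 / 200000 : ℝ) ^ 2 * N =
              2 * (1 / N) * (1 / 2) * ((1 / 200000 : ℝ) ^ 2 * (N ^ 2 : ℕ)) := by
              push_cast; field_simp
          _ ≤ _ := by gcongr; linarith

open MeasureTheory in
lemma abs_bimagicSquareSeries_sub_le {N : ℕ} (hN : 3 ≤ N) :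
    |(bimagicSquareSeries N : ℝ) * ((1 / N : ℝ) ^ N * (1 - 1 / N : ℝ) ^ (N ^ 2 - N)) -
        (phaseMatrix N).det * ∫ x in smallPhaseSet N, (scaledProd N x).re| ≤
      Real.exp (-((1 / 200000) ^ 2 * N)) := by
  have hsub := smallCoeffSet_subset_torusBox (N := N) (by omega)
  have hdiff := setIntegral_sdiff (isClosed_smallCoeffSet N).measurableSet
    (integrableOn_prod_bernoulliChar_quadPhase N) hsub
  obtain ⟨hint, heq⟩ := integrableOn_scaledProd_and_setIntegral_smallCoeffSet (N := N) (by omega)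
  have hvol : volume torusBox = 1 := by
    rw [torusBox, volume_pi_pi]
    norm_num [Real.volume_Icc]
  have hle : ‖∫ v in torusBox \ smallCoeffSet N, ∏ i ∈ Finset.range (N ^ 2),
      bernoulliChar (1 / N) (2 * Real.pi * quadPhase v i)‖ ≤
      Real.exp (-((1 / 200000) ^ 2 * N)) := by
    have hv : volume (torusBox \ smallCoeffSet N) ≤ 1 := hvol ▸ measure_mono Set.sdiff_subset
    refine (norm_setIntegral_le_of_norm_le_const (hv.trans_lt ENNReal.one_lt_top)
      fun v hv => norm_prod_bernoulliChar_le hN hv.1 hv.2).trans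
      (mul_le_of_le_one_right (Real.exp_nonneg _) ?_)
    exact ENNReal.toReal_le_of_le_ofReal zero_le_one (by simpa using hv)
  rw [hdiff, ← bimagicSquareSeries_mul_eq_integral (by omega), heq] at hle
  refine le_trans (le_of_eq ?_) ((Complex.abs_re_le_norm _).trans hle)
  have hre : (∫ x in smallPhaseSet N, scaledProd N x).re =
      ∫ x in smallPhaseSet N, (scaledProd N x).re := (integral_re hint).symm
  rw [Complex.sub_re, Complex.re_ofReal_mul, hre, ← Complex.ofReal_natCast, Complex.re_ofReal_mul,
    Complex.ofReal_re]

/-- The logarithm of the ratio between `√e · e⁻ᴺ` and `(1 - 1/N)^(N² - N)`. -/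
noncomputable def logRatio (N : ℕ) : ℝ :=
  1 / 2 - N - (N ^ 2 - N) * Real.log (1 - 1 / N)

open Topology in
lemma tendsto_natCast_mul_logRatio :
    Tendsto (fun N : ℕ => N * logRatio N) atTop (𝓝 (-1 / 6)) := by
  rw [tendsto_iff_norm_sub_tendsto_zero]
  have h3 : Tendsto (fun N : ℕ => 3 * (1 / (N : ℝ))) atTop (𝓝 0) := by
    simpa using tendsto_one_div_atTop_nhds_zero_nat.const_mul (3 : ℝ)
  refine squeeze_zero' (Eventually.of_forall fun _ => norm_nonneg _) ?_ h3
  filter_upwards [eventually_ge_atTop 2] with N hN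
  have hn : (2 : ℝ) ≤ N := by exact_mod_cast hN
  have hu0 : 0 < 1 / (N : ℝ) := by positivity
  have hu : 1 / (N : ℝ) ≤ 1 / 2 := one_div_le_one_div_of_le (by norm_num) hn
  have hlog := Real.abs_log_sub_add_sum_range_le (x := 1 / (N : ℝ))
    (by rw [abs_of_pos hu0]; linarith) 3
  rw [abs_of_pos hu0] at hlog
  have hlog' : |∑ i ∈ Finset.range 3, (1 / (N : ℝ)) ^ (i + 1) / (i + 1) +
      Real.log (1 - 1 / N)| ≤ 2 * (1 / (N : ℝ)) ^ 4 := by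
    refine hlog.trans ?_
    rw [div_le_iff₀ (by linarith)]
    nlinarith [pow_pos hu0 4]
  set L := Real.log (1 - 1 / (N : ℝ)) with hL
  set R := ∑ i ∈ Finset.range 3, (1 / (N : ℝ)) ^ (i + 1) / (i + 1) + L with hR
  have hLR : L = R - (1 / (N : ℝ) + (1 / (N : ℝ)) ^ 2 / 2 + (1 / (N : ℝ)) ^ 3 / 3) := by
    rw [hR]
    norm_num [Finset.sum_range_succ]
  have hid : N * logRatio N - -1 / 6 = -(1 / 3 * (1 / (N : ℝ))) - (N ^ 3 - N ^ 2) * R := by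
    rw [logRatio, ← hL, hLR]
    field_simp
    ring
  have hNR : (N ^ 3 - N ^ 2) * |R| ≤ 2 * (1 / (N : ℝ)) := by
    have hN3 : 0 ≤ (N : ℝ) ^ 3 - N ^ 2 := by nlinarith [sq_nonneg (N : ℝ)]
    calc (N ^ 3 - N ^ 2) * |R| ≤ (N ^ 3 - N ^ 2) * (2 * (1 / (N : ℝ)) ^ 4) := by gcongr
      _ ≤ N ^ 3 * (2 * (1 / (N : ℝ)) ^ 4) := by gcongr; nlinarith [sq_nonneg (N : ℝ)]
      _ = _ := by field_simp
  rw [hid, Real.norm_eq_abs]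
  have hN3 : 0 ≤ (N : ℝ) ^ 3 - N ^ 2 := by nlinarith [sq_nonneg (N : ℝ)]
  refine (abs_sub _ _).trans ?_
  rw [abs_neg, abs_of_pos (by positivity), abs_mul, abs_of_nonneg hN3]
  linarith

lemma prefactor_mul_det_phaseMatrix {N : ℕ} (hN : 2 ≤ N) :
    Real.pi ^ (3 / 2 : ℝ) / 6 * √(Real.exp 1 / 30) * (N : ℝ) ^ (15 / 2 : ℝ) *
        (((N : ℝ) * Real.exp 1) ^ N)⁻¹ * ((phaseMatrix N).det * √(2 * Real.pi) ^ 3) =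
      Real.exp (logRatio N) * ((1 / N : ℝ) ^ N * (1 - 1 / N : ℝ) ^ (N ^ 2 - N)) := by
  have hn : (2 : ℝ) ≤ N := by exact_mod_cast hN
  have hn0 : (0 : ℝ) < N := by linarith
  have hπ := Real.pi_pos
  have hu : 1 / (N : ℝ) ≤ 1 / 2 := one_div_le_one_div_of_le (by norm_num) hn
  have hpow : (1 - 1 / N : ℝ) ^ (N ^ 2 - N) =
      Real.exp ((N ^ 2 - N) * Real.log (1 - 1 / N)) := by
    rw [← Real.rpow_natCast, Real.rpow_def_of_pos (by linarith), mul_comm,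
      Nat.cast_sub (by nlinarith), Nat.cast_pow]
  have hrpow (y : ℝ) (hy : 0 < y) (k : ℕ) : y ^ ((k : ℝ) / 2) = √y ^ k := by
    rw [Real.sqrt_eq_rpow, ← Real.rpow_natCast, ← Real.rpow_mul hy.le]
    congr 1
    ring
  have h1 := hrpow Real.pi hπ 3
  have h2 := hrpow N hn0 15
  have hsq := Real.sq_sqrt hπ.le
  have hs2 : √(2 : ℝ) ^ 2 = 2 := Real.sq_sqrt (by norm_num)
  have hsN := Real.sq_sqrt hn0.le
  have h30 : √(30 : ℝ) = √2 * √3 * √5 := by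
    rw [← Real.sqrt_mul (by norm_num), ← Real.sqrt_mul (by norm_num)]; norm_num
  push_cast at h1 h2
  have hexp : Real.exp (logRatio N) * ((1 / N : ℝ) ^ N * (1 - 1 / N : ℝ) ^ (N ^ 2 - N)) =
      √(Real.exp 1) * (((N : ℝ) * Real.exp 1) ^ N)⁻¹ := by
    rw [hpow, mul_left_comm, ← Real.exp_add, ← Real.exp_half, mul_pow, mul_inv, ← Real.exp_nat_mul,
      ← Real.exp_neg, mul_left_comm, ← Real.exp_add, logRatio, one_div, inv_pow]
    congr 2
    ring
  rw [hexp, h1, h2, det_phaseMatrix, Real.sqrt_div (Real.exp_nonneg 1), h30,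
    Real.sqrt_mul (by norm_num)]
  have hc : √Real.pi ^ 3 / 6 * (1 / (√2 * √3 * √5)) * √(N : ℝ) ^ 15 *
      (24 * (√3 * √5) / ((2 * Real.pi * √N) ^ 3 * (N ^ 2) ^ 3) * (√2 * √Real.pi) ^ 3) = 1 := by
    have e1 : √Real.pi ^ 6 = Real.pi ^ 3 := by nth_rw 2 [← hsq]; ring
    have e2 : √(N : ℝ) ^ 12 = N ^ 6 := by nth_rw 2 [← hsN]; ring
    field_simp
    rw [e1, e2, hs2]
    ring
  linear_combination (√(Real.exp 1) * (((N : ℝ) * Real.exp 1) ^ N)⁻¹) * hc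

open Topology in
lemma tendsto_natCast_mul_exp_neg_div_det_phaseMatrix {c : ℝ} (hc : 0 < c) :
    Tendsto (fun N : ℕ => N * (Real.exp (-(c * N)) / ((phaseMatrix N).det * √(2 * Real.pi) ^ 3)))
      atTop (𝓝 0) := by
  have h := ((Real.tendsto_pow_mul_exp_neg_atTop_nhds_zero 9).comp
    (tendsto_natCast_atTop_atTop.const_mul_atTop hc)).const_mul
    ((2 * Real.pi) ^ 3 / (24 * (√3 * √5) * √(2 * Real.pi) ^ 3 * c ^ 9))
  rw [mul_zero] at h
  refine squeeze_zero' (Eventually.of_forall fun N => ?_) ?_ h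
  · rw [det_phaseMatrix]; positivity
  filter_upwards [eventually_ge_atTop 1] with N hN
  have hn : (1 : ℝ) ≤ N := by exact_mod_cast hN
  have hs : √(N : ℝ) ^ 3 ≤ N ^ 2 := by
    have h1 : 1 ≤ √(N : ℝ) := Real.one_le_sqrt.2 hn
    nlinarith [Real.sq_sqrt (by linarith : (0 : ℝ) ≤ N), pow_le_pow_right₀ h1 (by norm_num : 3 ≤ 4)]
  have hπ := Real.pi_pos
  simp only [Function.comp_apply]
  rw [det_phaseMatrix]
  calc _ = (2 * Real.pi) ^ 3 / (24 * (√3 * √5) * √(2 * Real.pi) ^ 3) *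
        (√(N : ℝ) ^ 3 * N ^ 7 * Real.exp (-(c * N))) := by
        field_simp
    _ ≤ (2 * Real.pi) ^ 3 / (24 * (√3 * √5) * √(2 * Real.pi) ^ 3) *
        (N ^ 2 * N ^ 7 * Real.exp (-(c * N))) := by gcongr
    _ = _ := by field_simp

/-- First-order asymptotic expansion for the number of bimagic square series:
`𝒩₂⁽²⁾(N) = (6/π^{3/2})√(30/e) (Ne)^N / N^{15/2} (1 + 1787/(2940N) + o(1/N))`, stated
as `(π^{3/2}/6)√(e/30) N^{15/2} (Ne)^{-N} 𝒩₂⁽²⁾(N) - (1 + 1787/(2940N)) = o(1/N)`. -/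
theorem bimagic_square_series_asymptotics :
    (fun N : ℕ =>
        Real.pi ^ (3 / 2 : ℝ) / 6 * Real.sqrt (Real.exp 1 / 30) *
            (N : ℝ) ^ (15 / 2 : ℝ) * (((N : ℝ) * Real.exp 1) ^ N)⁻¹ *
            (bimagicSquareSeries N : ℝ) -
          (1 + 1787 / (2940 * (N : ℝ))))
      =o[atTop] fun N : ℕ => 1 / (N : ℝ) := by
  have hA := tendsto_natCast_mul_exp_mul_cos_sub_one (b := 0) (β := 0)
    tendsto_natCast_mul_logRatio (by simp)
  have hS := tendsto_setIntegral_scaledProd_re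
  have hδ := tendsto_natCast_mul_exp_neg_div_det_phaseMatrix
    (c := (1 / 200000) ^ 2) (by norm_num)
  set s : ℝ := √(2 * Real.pi) ^ 3 with hs
  have hs0 : 0 < s := by positivity
  let P (N : ℕ) : ℝ := Real.pi ^ (3 / 2 : ℝ) / 6 * √(Real.exp 1 / 30) *
    (N : ℝ) ^ (15 / 2 : ℝ) * (((N : ℝ) * Real.exp 1) ^ N)⁻¹
  let w (N : ℕ) : ℝ := (1 / N : ℝ) ^ N * (1 - 1 / N : ℝ) ^ (N ^ 2 - N)
  let S (N : ℕ) : ℝ := ∫ x in smallPhaseSet N, (scaledProd N x).re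
  let J (N : ℕ) : ℝ := (phaseMatrix N).det
  let δ (N : ℕ) : ℝ := (bimagicSquareSeries N * w N - J N * S N) / (J N * s)
  have hδ' : Tendsto (fun N : ℕ => N * δ N) atTop (nhds 0) := by
    refine squeeze_zero_norm' ?_ hδ
    filter_upwards [eventually_ge_atTop 3] with N hN
    have hn : (0 : ℝ) < N := by
      have : 0 < N := by omega
      exact_mod_cast this
    have hJ : 0 < J N := by simp only [J, det_phaseMatrix]; positivity
    rw [Real.norm_eq_abs, abs_mul, abs_of_pos hn, abs_div, abs_of_pos (mul_pos hJ hs0)]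
    have := abs_bimagicSquareSeries_sub_le hN
    gcongr
  have hid : ∀ᶠ N : ℕ in atTop, P N * bimagicSquareSeries N =
      Real.exp (logRatio N) * (S N / s + δ N) := by
    filter_upwards [eventually_ge_atTop 3] with N hN
    have hn : (3 : ℝ) ≤ N := by exact_mod_cast hN
    have hJ : 0 < J N := by simp only [J, det_phaseMatrix]; positivity
    have hw : 0 < w N := by
      have hu : 1 / (N : ℝ) ≤ 1 / 3 := one_div_le_one_div_of_le (by norm_num) hn
      have : 0 < 1 - 1 / (N : ℝ) := by linarith
      positivity
    have h := prefactor_mul_det_phaseMatrix (N := N) (by omega)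
    change P N * (J N * s) = Real.exp (logRatio N) * w N at h
    have hδN : S N / s + δ N = bimagicSquareSeries N * w N / (J N * s) := by
      simp only [δ]; field_simp; ring
    rw [hδN, mul_div_assoc', eq_div_iff (mul_pos hJ hs0).ne']
    linear_combination (bimagicSquareSeries N : ℝ) * h
  have hinv : Tendsto (fun N : ℕ => 1 / (N : ℝ)) atTop (nhds 0) :=
    tendsto_one_div_atTop_nhds_zero_nat
  have hY := hS.add hδ'
  rw [add_zero] at hY
  have hprod := (hA.add hY).add ((hA.mul hY).mul hinv)
  rw [isLittleO_iff_tendsto']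
  swap
  · filter_upwards [eventually_gt_atTop 0] with N hN h
    have : (0 : ℝ) < N := by exact_mod_cast hN
    exact absurd h (by positivity)
  have hlim := hprod.sub_const (1787 / 2940)
  norm_num at hlim
  refine hlim.congr' ?_
  filter_upwards [hid, eventually_gt_atTop 0] with N h hN
  have hn : (0 : ℝ) < N := by exact_mod_cast hN
  change _ = (P N * bimagicSquareSeries N - (1 + 1787 / (2940 * (N : ℝ)))) / (1 / N)
  rw [h]
  simp only [S]
  field_simp
  ring
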